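/- Set I = O_{g,n}(V) ∩ V^0. Then O_{1,l}(V^0) ⊆ I and I/O_{1,l}(V^0) is a two-sided ideal of the untwisted associative algebra A_{1,l}(V^0) = V^0/O_{1,l}(V^0). -/

import Mathlib

/-
Common framework for formalizing
"Twisted representations of vertex operator algebras and associative algebras"
by C. Dong, H. Li, G. Mason.

We formalize a vertex operator algebra `V` over `ℂ` through its modes
`u_m = mode u m` (`m : ℤ`), vacuum `𝟏`, conformal vector `ω` (so that
`L(n) = ω_{n+1}`), a weight grading `wtSpace`, and the Borcherds identity.
An automorphism `g` of finite order `T` gives eigenspaces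
`V^r = eigSpace V g T r`.  For `n = l + i/T` the subspace `O_{g,n}(V)` is
`Ogn V g T l i`, the product `*_{g,n}` is `starMul V g T l`
(it only depends on `l`), and `A_{g,n}(V) = V.carrier ⧸ Ogn V g T l i`.
-/

noncomputable section

open scoped BigOperators

namespace DLM

/-- Generalized binomial coefficient `binom(α, j)` for a rational `α`. -/
def qchoose (α : ℚ) (j : ℕ) : ℚ :=
  (∏ k ∈ Finset.range j, (α - (k : ℚ))) / (Nat.factorial j : ℚ)

/-- A vertex operator algebra over `ℂ`, given by its modes `u_m v = mode u m v`
(the coefficients of `Y(u,z)v`), the vacuum `𝟏`, the conformal vector `ω`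
(with `L(n) = ω_{n+1}`), and the integer weight grading. -/
structure VOA where
  carrier : Type
  [acg : AddCommGroup carrier]
  [mod : Module ℂ carrier]
  mode : carrier →ₗ[ℂ] (ℤ → carrier →ₗ[ℂ] carrier)
  vacuum : carrier
  conformal : carrier
  wtSpace : ℤ → Submodule ℂ carrier
  [decomp : DirectSum.Decomposition wtSpace]
  findim : ∀ k : ℤ, FiniteDimensional ℂ (wtSpace k)
  bounded_below : ∃ N : ℤ, ∀ k : ℤ, k < N → wtSpace k = ⊥
  trunc : ∀ u v : carrier, ∃ N : ℤ, ∀ m : ℤ, N ≤ m → mode u m v = 0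
  vacuum_wt : vacuum ∈ wtSpace 0
  conformal_wt : conformal ∈ wtSpace 2
  vacuum_mode : ∀ (m : ℤ) (v : carrier), mode vacuum m v = if m = -1 then v else 0
  creation₁ : ∀ u : carrier, mode u (-1) vacuum = u
  creation₂ : ∀ (u : carrier) (m : ℤ), 0 ≤ m → mode u m vacuum = 0
  L0_grading : ∀ (k : ℤ), ∀ v ∈ wtSpace k, mode conformal 1 v = (k : ℂ) • v
  mode_grading : ∀ (a b m : ℤ) (u v : carrier), u ∈ wtSpace a → v ∈ wtSpace b →
    mode u m v ∈ wtSpace (a + b - m - 1)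
  Lneg1_mode : ∀ (u : carrier) (m : ℤ),
    mode (mode conformal 0 u) m = (-(m : ℂ)) • (mode u (m - 1))
  borcherds : ∀ (u v w : carrier) (p q s : ℤ),
    ∑ᶠ j : ℕ, ((qchoose (p : ℚ) j : ℚ) : ℂ) • mode (mode u (s + j) v) (p + q - j) w =
    ∑ᶠ j : ℕ, ((-1 : ℂ) ^ j * ((qchoose (s : ℚ) j : ℚ) : ℂ)) •
      (mode u (p + s - j) (mode v (q + j) w)
        - ((-1 : ℂ) ^ s) • mode v (q + s - j) (mode u (p + j) w))

attribute [instance] VOA.acg VOA.mod VOA.decomp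

namespace VOA

/-- Projection of `u` onto its weight `k` homogeneous component. -/
def proj (V : VOA) (k : ℤ) (u : V.carrier) : V.carrier :=
  (((DirectSum.decompose V.wtSpace u) k : V.wtSpace k) : V.carrier)

/-- `res V α β u v = Res_z Y(u,z)v (1+z)^α z^{-β}
  = ∑_{j ≥ 0} binom(α, j) u_{j - β} v`. -/
def res (V : VOA) (α : ℚ) (β : ℤ) (u v : V.carrier) : V.carrier :=
  ∑ᶠ j : ℕ, ((qchoose α j : ℚ) : ℂ) • V.mode u ((j : ℤ) - β) v

end VOA

/-- An automorphism of a vertex operator algebra. -/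
structure VOAAut (V : VOA) where
  lin : V.carrier ≃ₗ[ℂ] V.carrier
  map_vacuum : lin V.vacuum = V.vacuum
  map_conformal : lin V.conformal = V.conformal
  map_mode : ∀ (u : V.carrier) (m : ℤ) (v : V.carrier),
    lin (V.mode u m v) = V.mode (lin u) m (lin v)
  map_wt : ∀ (k : ℤ) (u : V.carrier), u ∈ V.wtSpace k ↔ lin u ∈ V.wtSpace k

/-- The inverse automorphism `g⁻¹`. -/
def VOAAut.symm {V : VOA} (g : VOAAut V) : VOAAut V where
  lin := g.lin.symm
  map_vacuum := g.lin.injective (by rw [LinearEquiv.apply_symm_apply, g.map_vacuum])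
  map_conformal := g.lin.injective (by rw [LinearEquiv.apply_symm_apply, g.map_conformal])
  map_mode := fun u m v => g.lin.injective (by
    rw [LinearEquiv.apply_symm_apply, g.map_mode, LinearEquiv.apply_symm_apply,
      LinearEquiv.apply_symm_apply])
  map_wt := fun k u => by
    have h := (g.map_wt k (g.lin.symm u)).symm
    rwa [LinearEquiv.apply_symm_apply] at h

/-- The eigenspace `V^r = {v ∈ V | g v = e^{-2πir/T} v}`. -/
def eigSpace (V : VOA) (g : VOAAut V) (T r : ℕ) : Submodule ℂ V.carrier where
  carrier := {v | g.lin v =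
    Complex.exp (-(2 * (Real.pi : ℂ) * Complex.I * (r : ℂ)) / (T : ℂ)) • v}
  add_mem' := fun {a b} ha hb => by
    simp only [Set.mem_setOf_eq] at *
    rw [map_add, ha, hb, smul_add]
  zero_mem' := by simp
  smul_mem' := fun c a ha => by
    simp only [Set.mem_setOf_eq] at *
    rw [map_smul, ha, smul_comm]

/-- `δ_i(r)`: equals `1` if `r ≤ i` or `r = T`, and `0` otherwise. -/
def deltaI (T i r : ℕ) : ℕ := if r ≤ i ∨ r = T then 1 else 0

/-- `O_{g,n}(V)` for `n = l + i/T`: the span of all `L(-1)u + L(0)u` and all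
`u ∘_{g,n} v = Res_z Y(u,z)v (1+z)^{wt u - 1 + δ_i(r) + l + r/T}
 / z^{2l + δ_i(r) + δ_i(T-r)}` for homogeneous `u ∈ V^r`. -/
def Ogn (V : VOA) (g : VOAAut V) (T l i : ℕ) : Submodule ℂ V.carrier :=
  Submodule.span ℂ
    ({x | ∃ u : V.carrier, x = V.mode V.conformal 0 u + V.mode V.conformal 1 u} ∪
     {x | ∃ r : ℕ, r < T ∧ ∃ (k : ℤ) (u v : V.carrier),
        u ∈ V.wtSpace k ∧ u ∈ eigSpace V g T r ∧
        x = V.res ((k : ℚ) - 1 + (deltaI T i r : ℚ) + (l : ℚ) + (r : ℚ) / (T : ℚ))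
              (2 * (l : ℤ) + (deltaI T i r : ℤ) + (deltaI T i (T - r) : ℤ)) u v})

/-- The product `u *_{g,n} v` for `u` homogeneous of weight `k` in `V^0`:
`∑_{m=0}^{l} (-1)^m binom(m+l, l) Res_z Y(u,z) (1+z)^{wt u + l} z^{-(l+m+1)} v`. -/
def starFor (V : VOA) (l : ℕ) (k : ℤ) (u v : V.carrier) : V.carrier :=
  ∑ m ∈ Finset.range (l + 1),
    ((-1 : ℂ) ^ m * (Nat.choose (m + l) l : ℂ)) •
      V.res ((k : ℚ) + (l : ℚ)) ((l : ℤ) + (m : ℤ) + 1) u v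

/-- Projection onto the eigenspace `V^r` of the finite order automorphism `g`. -/
def eigProj (V : VOA) (g : VOAAut V) (T r : ℕ) (v : V.carrier) : V.carrier :=
  (T : ℂ)⁻¹ • ∑ t ∈ Finset.range T,
    Complex.exp ((2 * (Real.pi : ℂ) * Complex.I * (r : ℂ) * (t : ℂ)) / (T : ℂ)) •
      ((g.lin ^ t) v)

/-- The bilinear extension of `*_{g,n}` to all of `V` (it vanishes when the first
argument is homogeneous in `V^r`, `r ≠ 0`, and only depends on `l`). -/
def starMul (V : VOA) (g : VOAAut V) (T l : ℕ) (u v : V.carrier) : V.carrier :=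
  ∑ᶠ k : ℤ, starFor V l k (eigProj V g T 0 (V.proj k u)) v

/-- The subspace `O_{1,l}(V^0)` of the untwisted theory of the fixed point
subalgebra `V^0` (all `δ` terms equal `1`), viewed inside `V`. -/
def OgnV0 (V : VOA) (g : VOAAut V) (T l : ℕ) : Submodule ℂ V.carrier :=
  Submodule.span ℂ
    ({x | ∃ u ∈ eigSpace V g T 0, x = V.mode V.conformal 0 u + V.mode V.conformal 1 u} ∪
     {x | ∃ (k : ℤ) (u v : V.carrier),
        u ∈ V.wtSpace k ∧ u ∈ eigSpace V g T 0 ∧ v ∈ eigSpace V g T 0 ∧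
        x = V.res ((k : ℚ) + (l : ℚ)) (2 * (l : ℤ) + 2) u v})

/-- `e^{L(1)} v` (where `L(1) = ω_2`). -/
def expL1 (V : VOA) (v : V.carrier) : V.carrier :=
  ∑ᶠ j : ℕ, ((Nat.factorial j : ℂ))⁻¹ • ((fun w => V.mode V.conformal 2 w)^[j] v)

/-- The map `φ : v ↦ e^{L(1)} (-1)^{L(0)} v`. -/
def phiMap (V : VOA) (v : V.carrier) : V.carrier :=
  ∑ᶠ k : ℤ, ((-1 : ℂ) ^ k) • expL1 V (V.proj k v)

/-- `l`-component of `n - 1/T` when `n = l + i/T`. -/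
def predL (l i : ℕ) : ℕ := if i = 0 then l - 1 else l

/-- `i`-component of `n - 1/T` when `n = l + i/T`. -/
def predI (T i : ℕ) : ℕ := if i = 0 then T - 1 else i - 1

/-- The rational number `n = l + i/T`. -/
def nval (T l i : ℕ) : ℚ := (l : ℚ) + (i : ℚ) / (T : ℚ)

/-- A weak `g`-twisted `V`-module: modes `v_m = act v m` for `m ∈ (1/T)ℤ ⊆ ℚ`,
satisfying the truncation, vacuum and twisted Borcherds (Jacobi) identities. -/
structure TwModule (V : VOA) (g : VOAAut V) (T : ℕ) where
  carrier : Type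
  [acg : AddCommGroup carrier]
  [mod : Module ℂ carrier]
  act : V.carrier →ₗ[ℂ] (ℚ → carrier →ₗ[ℂ] carrier)
  act_eig : ∀ r : ℕ, r < T → ∀ u ∈ eigSpace V g T r, ∀ m : ℚ,
    (¬ ∃ z : ℤ, m = (z : ℚ) + (r : ℚ) / (T : ℚ)) → act u m = 0
  act_trunc : ∀ (u : V.carrier) (x : carrier), ∃ N : ℤ, ∀ m : ℚ, (N : ℚ) ≤ m → act u m x = 0
  act_vacuum : ∀ (m : ℚ) (x : carrier), act V.vacuum m x = if m = -1 then x else 0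
  jacobi : ∀ r s : ℕ, r < T → s < T → ∀ u ∈ eigSpace V g T r, ∀ v ∈ eigSpace V g T s,
    ∀ (a b c : ℤ) (x : carrier),
    ∑ᶠ j : ℕ, ((qchoose ((r : ℚ) / (T : ℚ) + (a : ℚ)) j : ℚ) : ℂ) •
        act (V.mode u (c + j) v) ((r : ℚ) / (T : ℚ) + (s : ℚ) / (T : ℚ) + a + b - j) x =
    ∑ᶠ j : ℕ, ((-1 : ℂ) ^ j * ((qchoose (c : ℚ) j : ℚ) : ℂ)) •
        (act u ((r : ℚ) / (T : ℚ) + a + c - j) (act v ((s : ℚ) / (T : ℚ) + b + j) x)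
          - ((-1 : ℂ) ^ c) •
            act v ((s : ℚ) / (T : ℚ) + b + c - j) (act u ((r : ℚ) / (T : ℚ) + a + j) x))

attribute [instance] TwModule.acg TwModule.mod

namespace TwModule

variable {V : VOA} {g : VOAAut V} {T : ℕ}

/-- The operator `o_p(a) = a_{wt a - 1 - p}`, extended linearly from homogeneous `a`. -/
def oactL (M : TwModule V g T) (p : ℚ) (a : V.carrier) : M.carrier →ₗ[ℂ] M.carrier :=
  ∑ᶠ k : ℤ, M.act (V.proj k a) ((k : ℚ) - 1 - p)

/-- `Ω_n(M) = {x ∈ M | V[g]_{-k} x = 0 for all k > n}`, i.e. `v_m x = 0` whenever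
`v` is homogeneous of weight `d` and `d - 1 - m < -n`. -/
def Omega (M : TwModule V g T) (n : ℚ) : Submodule ℂ M.carrier where
  carrier := {x | ∀ (k : ℤ) (u : V.carrier), u ∈ V.wtSpace k → ∀ m : ℚ,
    (k : ℚ) - 1 + n < m → M.act u m x = 0}
  add_mem' := fun {a b} ha hb => by
    intro k u hu m hm
    rw [map_add, ha k u hu m hm, hb k u hu m hm, add_zero]
  zero_mem' := fun k u hu m hm => map_zero _
  smul_mem' := fun c a ha => by
    intro k u hu m hm
    rw [map_smul, ha k u hu m hm, smul_zero]

theorem mem_Omega {M : TwModule V g T} {n : ℚ} {x : M.carrier} :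
    x ∈ M.Omega n ↔ ∀ (k : ℤ) (u : V.carrier), u ∈ V.wtSpace k → ∀ m : ℚ,
      (k : ℚ) - 1 + n < m → M.act u m x = 0 := Iff.rfl

/-- `Ω_{n-1/T}(M)`, viewed as a submodule of `Ω_n(M)`. -/
def OmegaSub (M : TwModule V g T) (n : ℚ) : Submodule ℂ (M.Omega n) :=
  (M.Omega (n - 1 / (T : ℚ))).comap (M.Omega n).subtype

/-- The quotient `Ω_n(M)/Ω_{n-1/T}(M)`. -/
abbrev OmegaQ (M : TwModule V g T) (n : ℚ) :=
  (M.Omega n) ⧸ (M.OmegaSub n)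

open Classical in
/-- The action of `o(a)` on `Ω_n(M)` (it does preserve `Ω_n(M)`). -/
def oactOmega (M : TwModule V g T) (n : ℚ) (a : V.carrier) :
    M.Omega n →ₗ[ℂ] M.Omega n :=
  if h : ∀ x ∈ M.Omega n, M.oactL 0 a x ∈ M.Omega n then (M.oactL 0 a).restrict h else 0

open Classical in
/-- The induced action of `o(a)` on `Ω_n(M)/Ω_{n-1/T}(M)`. -/
def oactQ (M : TwModule V g T) (n : ℚ) (a : V.carrier) :
    M.OmegaQ n →ₗ[ℂ] M.OmegaQ n :=
  if h : M.OmegaSub n ≤ (M.OmegaSub n).comap (M.oactOmega n a) then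
    Submodule.mapQ _ _ (M.oactOmega n a) h
  else 0

end TwModule

/-- A morphism of weak `g`-twisted `V`-modules. -/
structure TwHom {V : VOA} {g : VOAAut V} {T : ℕ} (M N : TwModule V g T) where
  toLin : M.carrier →ₗ[ℂ] N.carrier
  comm : ∀ (u : V.carrier) (m : ℚ) (x : M.carrier), toLin (M.act u m x) = N.act u m (toLin x)

namespace TwHom

variable {V : VOA} {g : VOAAut V} {T : ℕ}

def id (M : TwModule V g T) : TwHom M M := ⟨LinearMap.id, fun _ _ _ => rfl⟩

def comp {M N P : TwModule V g T} (f' : TwHom N P) (f : TwHom M N) : TwHom M P :=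
  ⟨f'.toLin.comp f.toLin, fun u m x => by
    simp only [LinearMap.comp_apply, f.comm, f'.comm]⟩

theorem mapsOmega {M N : TwModule V g T} (f : TwHom M N) (n : ℚ) :
    ∀ x ∈ M.Omega n, f.toLin x ∈ N.Omega n := fun x hx k u hu m hm => by
  rw [← f.comm, hx k u hu m hm, map_zero]

/-- The restriction of a morphism to `Ω_n`. -/
def omegaMap {M N : TwModule V g T} (f : TwHom M N) (n : ℚ) :
    M.Omega n →ₗ[ℂ] N.Omega n :=
  f.toLin.restrict (f.mapsOmega n)

/-- The induced map `Ω_n(M)/Ω_{n-1/T}(M) → Ω_n(N)/Ω_{n-1/T}(N)`. -/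
def omegaQMap {M N : TwModule V g T} (f : TwHom M N) (n : ℚ) :
    M.OmegaQ n →ₗ[ℂ] N.OmegaQ n :=
  Submodule.mapQ _ _ (f.omegaMap n) (fun x hx => f.mapsOmega (n - 1 / (T : ℚ)) x.1 hx)

end TwHom

/-- An admissible (`(1/T)ℤ≥0`-graded) `g`-twisted `V`-module. -/
structure AdmTwModule (V : VOA) (g : VOAAut V) (T : ℕ) extends TwModule V g T where
  grade : ℚ → Submodule ℂ carrier
  [gdecomp : DirectSum.Decomposition grade]
  grade_support : ∀ q : ℚ, (q < 0 ∨ ¬ ∃ z : ℤ, q = (z : ℚ) / (T : ℚ)) → grade q = ⊥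
  grade_act : ∀ (k : ℤ) (u : V.carrier), u ∈ V.wtSpace k → ∀ (m p : ℚ), ∀ x ∈ grade p,
    act u m x ∈ grade (p + (k : ℚ) - m - 1)

attribute [instance] AdmTwModule.gdecomp

namespace AdmTwModule

variable {V : VOA} {g : VOAAut V} {T : ℕ}

/-- A submodule invariant under all twisted vertex operators. -/
def InvSub (M : AdmTwModule V g T) (W : Submodule ℂ M.carrier) : Prop :=
  ∀ (u : V.carrier) (m : ℚ), ∀ x ∈ W, M.act u m x ∈ W

/-- A graded submodule (closed under homogeneous components). -/
def GradedSub (M : AdmTwModule V g T) (W : Submodule ℂ M.carrier) : Prop :=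
  ∀ x ∈ W, ∀ q : ℚ, (((DirectSum.decompose M.grade x) q : M.grade q) : M.carrier) ∈ W

/-- A simple (irreducible) admissible module: nonzero, with no proper nonzero
graded submodule. -/
def IsSimple (M : AdmTwModule V g T) : Prop :=
  (∃ x : M.carrier, x ≠ 0) ∧
  ∀ W : Submodule ℂ M.carrier, M.InvSub W → M.GradedSub W → W = ⊥ ∨ W = ⊤

/-- `W` is a simple (irreducible) admissible submodule of `M`. -/
def SubSimple (M : AdmTwModule V g T) (W : Submodule ℂ M.carrier) : Prop :=
  W ≠ ⊥ ∧ ∀ W' : Submodule ℂ M.carrier, W' ≤ W → M.InvSub W' → M.GradedSub W' →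
    W' = ⊥ ∨ W' = W

/-- `M` is a direct sum of irreducible admissible submodules. -/
def CompletelyReducible (M : AdmTwModule V g T) : Prop :=
  ∃ (κ : Type) (S : κ → Submodule ℂ M.carrier),
    (∀ j, M.InvSub (S j) ∧ M.GradedSub (S j) ∧ M.SubSimple (S j)) ∧
    iSupIndep S ∧ (⨆ j, S j) = ⊤

end AdmTwModule

/-- `V` is `g`-rational: every admissible `g`-twisted module is a direct sum of
irreducible admissible `g`-twisted modules. -/
def GRational (V : VOA) (g : VOAAut V) (T : ℕ) : Prop :=
  ∀ M : AdmTwModule V g T, M.CompletelyReducible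

/-- An ordinary `g`-twisted `V`-module: graded by `L(0)`-eigenvalues with
finite dimensional pieces and spectrum bounded below in each congruence class
mod `(1/T)ℤ`. -/
structure OrdTwModule (V : VOA) (g : VOAAut V) (T : ℕ) extends TwModule V g T where
  egrade : ℂ → Submodule ℂ carrier
  [edecomp : DirectSum.Decomposition egrade]
  egrade_L0 : ∀ lam : ℂ, ∀ x ∈ egrade lam, act V.conformal 1 x = lam • x
  egrade_findim : ∀ lam : ℂ, FiniteDimensional ℂ (egrade lam)
  egrade_bounded : ∀ lam : ℂ, ∃ N : ℤ, ∀ m : ℤ, m ≤ N →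
    egrade (lam + (m : ℂ) / (T : ℂ)) = ⊥

attribute [instance] OrdTwModule.edecomp

/-- A module over the associative algebra `A_{g,n}(V)` (with `n = l + i/T`),
given as a representation of `V` that kills `O_{g,n}(V)`, takes the vacuum to
the identity, and turns `*_{g,n}` into composition. -/
structure AMod (V : VOA) (g : VOAAut V) (T l i : ℕ) where
  carrier : Type
  [acg : AddCommGroup carrier]
  [mod : Module ℂ carrier]
  rho : V.carrier →ₗ[ℂ] (carrier →ₗ[ℂ] carrier)
  rho_O : ∀ a ∈ Ogn V g T l i, rho a = 0
  rho_one : rho V.vacuum = LinearMap.id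
  rho_star : ∀ a b : V.carrier, rho (starMul V g T l a b) = (rho a).comp (rho b)

attribute [instance] AMod.acg AMod.mod

namespace AMod

variable {V : VOA} {g : VOAAut V} {T l i : ℕ}

/-- `U` does not factor through `A_{g,n-1/T}(V)`. -/
def NotFactor (U : AMod V g T l i) : Prop :=
  ∃ a ∈ Ogn V g T (predL l i) (predI T i), U.rho a ≠ 0

/-- An invariant subspace. -/
def SubInv (U : AMod V g T l i) (W : Submodule ℂ U.carrier) : Prop :=
  ∀ a : V.carrier, ∀ x ∈ W, U.rho a x ∈ W

/-- `W` is a simple `A_{g,n}(V)`-submodule of `U`. -/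
def SubSimple (U : AMod V g T l i) (W : Submodule ℂ U.carrier) : Prop :=
  W ≠ ⊥ ∧ ∀ W' : Submodule ℂ U.carrier, W' ≤ W → U.SubInv W' → W' = ⊥ ∨ W' = W

/-- `U` is a simple `A_{g,n}(V)`-module. -/
def IsSimple (U : AMod V g T l i) : Prop :=
  (∃ x : U.carrier, x ≠ 0) ∧ ∀ W : Submodule ℂ U.carrier, U.SubInv W → W = ⊥ ∨ W = ⊤

/-- `U` is a direct sum of simple `A_{g,n}(V)`-modules. -/
def CompletelyReducible (U : AMod V g T l i) : Prop :=
  ∃ (κ : Type) (S : κ → Submodule ℂ U.carrier),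
    (∀ j, U.SubInv (S j) ∧ U.SubSimple (S j)) ∧ iSupIndep S ∧ (⨆ j, S j) = ⊤

/-- All irreducible components of `U` do not factor through `A_{g,n-1/T}(V)`. -/
def GoodComponents (U : AMod V g T l i) : Prop :=
  ∀ W : Submodule ℂ U.carrier, U.SubInv W → U.SubSimple W →
    ∃ a ∈ Ogn V g T (predL l i) (predI T i), ∃ x ∈ W, U.rho a x ≠ 0

end AMod

/-- A morphism of `A_{g,n}(V)`-modules. -/
structure AModHom {V : VOA} {g : VOAAut V} {T l i : ℕ} (U U' : AMod V g T l i) where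
  toLin : U.carrier →ₗ[ℂ] U'.carrier
  comm : ∀ (a : V.carrier) (x : U.carrier), toLin (U.rho a x) = U'.rho a (toLin x)

namespace AModHom

variable {V : VOA} {g : VOAAut V} {T l i : ℕ}

def id (U : AMod V g T l i) : AModHom U U := ⟨LinearMap.id, fun _ _ => rfl⟩

def comp {U U' U'' : AMod V g T l i} (f' : AModHom U' U'') (f : AModHom U U') :
    AModHom U U'' :=
  ⟨f'.toLin.comp f.toLin, fun a x => by simp only [LinearMap.comp_apply, f.comm, f'.comm]⟩

end AModHom

end DLM
namespace DLM

section Binomials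

theorem qchoose_eq_choose (α : ℚ) (j : ℕ) : qchoose α j = Ring.choose α j := by
  have h1 : ∏ k ∈ Finset.range j, (α - (k : ℚ)) = (descPochhammer ℤ j).smeval α := by
    induction j with
    | zero => simp [Polynomial.smeval_one]
    | succ j ih =>
      rw [Finset.prod_range_succ, ih, descPochhammer_succ_right, Polynomial.smeval_mul,
        Polynomial.smeval_sub, Polynomial.smeval_X, Polynomial.smeval_natCast]
      simp
  have h2 := Ring.descPochhammer_eq_factorial_smul_choose α j
  have h3 : (Nat.factorial j : ℚ) ≠ 0 := by positivity
  rw [qchoose, h1, h2, nsmul_eq_mul]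
  field_simp

theorem qchoose_zero (α : ℚ) : qchoose α 0 = 1 := by simp [qchoose]

theorem qchoose_one (α : ℚ) : qchoose α 1 = α := by simp [qchoose]

theorem qchoose_succ (α : ℚ) (j : ℕ) :
    ((j : ℚ) + 1) * qchoose α (j + 1) = (α - j) * qchoose α j := by
  have h3 : (Nat.factorial j : ℚ) ≠ 0 := by positivity
  simp only [qchoose, Finset.prod_range_succ, Nat.factorial_succ]
  push_cast
  field_simp

theorem qchoose_add_one_succ (α : ℚ) (j : ℕ) :
    ((j : ℚ) + 1) * qchoose (α + 1) (j + 1) = (α + 1) * qchoose α j := by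
  have h3 : (Nat.factorial j : ℚ) ≠ 0 := by positivity
  simp only [qchoose, Finset.prod_range_succ', Nat.factorial_succ]
  push_cast
  simp only [add_sub_add_right_eq_sub, sub_zero]
  field_simp

theorem qchoose_pascal (α : ℚ) (j : ℕ) :
    qchoose (α + 1) (j + 1) = qchoose α (j + 1) + qchoose α j := by
  have h : ((j : ℚ) + 1) ≠ 0 := by positivity
  apply mul_left_cancel₀ h
  rw [qchoose_add_one_succ, mul_add, qchoose_succ]
  ring

theorem qchoose_add (α β : ℚ) (n : ℕ) :
    qchoose (α + β) n = ∑ i ∈ Finset.range (n + 1), qchoose α i * qchoose β (n - i) := by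
  simp only [qchoose_eq_choose]
  rw [Ring.add_choose_eq n (Commute.all α β),
    Finset.Nat.sum_antidiagonal_eq_sum_range_succ_mk]

theorem qchoose_neg (α : ℚ) (j : ℕ) :
    qchoose (-α) j = (-1) ^ j * qchoose (α + j - 1) j := by
  have h : ∏ k ∈ Finset.range j, (-α - (k : ℚ)) =
      (-1) ^ j * ∏ k ∈ Finset.range j, (α + j - 1 - (k : ℚ)) := by
    rw [← Finset.prod_range_reflect]
    calc _ = ∏ k ∈ Finset.range j, (-1) * (α + j - 1 - (k : ℚ)) := by
          refine Finset.prod_congr rfl fun k hk => ?_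
          have := Finset.mem_range.1 hk
          rw [show j - 1 - k = j - (1 + k) by omega, Nat.cast_sub (by omega)]
          push_cast
          ring
      _ = _ := by rw [Finset.prod_mul_distrib, Finset.prod_const, Finset.card_range]
  rw [qchoose, qchoose, h, mul_div_assoc]

theorem qchoose_mul_qchoose (α : ℚ) (m t : ℕ) :
    qchoose α (m + t) * qchoose ((m + t : ℕ) : ℚ) m = qchoose α m * qchoose (α - m) t := by
  induction t with
  | zero =>
    have : qchoose (m : ℚ) m = 1 := by
      rw [qchoose_eq_choose, Ring.choose_natCast]; simp
    simp [qchoose_zero, this]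
  | succ t ih =>
    have h1 := qchoose_succ α (m + t)
    have h2 := qchoose_succ (α - m) t
    have h3 : qchoose ((m + t + 1 : ℕ) : ℚ) m * ((t : ℚ) + 1) =
        ((m : ℚ) + t + 1) * qchoose ((m + t : ℕ) : ℚ) m := by
      simp only [qchoose_eq_choose, Ring.choose_natCast]
      have := Nat.choose_mul_succ_eq (m + t) m
      rw [show m + t + 1 - m = t + 1 by omega] at this
      have h := congrArg (Nat.cast : ℕ → ℚ) this
      push_cast at h
      linarith
    have ht : ((t : ℚ) + 1) ≠ 0 := by positivity
    have hmt : ((m : ℚ) + t + 1) ≠ 0 := by positivity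
    apply mul_left_cancel₀ ht
    apply mul_left_cancel₀ hmt
    rw [← add_assoc]
    push_cast at h1 h2 h3 ih ⊢
    linear_combination ((t : ℚ) + 1) * qchoose ((m : ℚ) + t + 1) m * h1
      + (α - (m + t)) * qchoose α (m + t) * h3 + (α - (m + t)) * ((m : ℚ) + t + 1) * ih
      - ((m : ℚ) + t + 1) * qchoose α m * h2

/-- The complex number `binom(α, j)`. -/
def bc (α : ℚ) (j : ℕ) : ℂ := ((qchoose α j : ℚ) : ℂ)

theorem bc_zero (α : ℚ) : bc α 0 = 1 := by simp [bc, qchoose_zero]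

theorem bc_one (α : ℚ) : bc α 1 = α := by simp [bc, qchoose_one]

theorem bc_succ (α : ℚ) (j : ℕ) : ((j : ℂ) + 1) * bc α (j + 1) = ((α : ℂ) - j) * bc α j := by
  have := congrArg (Rat.cast : ℚ → ℂ) (qchoose_succ α j)
  push_cast at this; exact this

theorem bc_add_one_succ (α : ℚ) (j : ℕ) :
    ((j : ℂ) + 1) * bc (α + 1) (j + 1) = ((α : ℂ) + 1) * bc α j := by
  have := congrArg (Rat.cast : ℚ → ℂ) (qchoose_add_one_succ α j)
  push_cast at this; exact this

theorem bc_pascal (α : ℚ) (j : ℕ) : bc (α + 1) (j + 1) = bc α (j + 1) + bc α j := by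
  have := congrArg (Rat.cast : ℚ → ℂ) (qchoose_pascal α j)
  push_cast at this; exact this

theorem bc_add (α β : ℚ) (n : ℕ) :
    bc (α + β) n = ∑ i ∈ Finset.range (n + 1), bc α i * bc β (n - i) := by
  have := congrArg (Rat.cast : ℚ → ℂ) (qchoose_add α β n)
  push_cast at this; exact this

theorem bc_neg (α : ℚ) (j : ℕ) : bc (-α) j = (-1) ^ j * bc (α + j - 1) j := by
  have := congrArg (Rat.cast : ℚ → ℂ) (qchoose_neg α j)
  push_cast at this; exact this

theorem bc_mul_bc (α : ℚ) (m t : ℕ) :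
    bc α (m + t) * bc ((m + t : ℕ) : ℚ) m = bc α m * bc (α - m) t := by
  have := congrArg (Rat.cast : ℚ → ℂ) (qchoose_mul_qchoose α m t)
  push_cast at this
  simpa [bc] using this

theorem bc_natCast_of_lt {t m : ℕ} (h : t < m) : bc (t : ℚ) m = 0 := by
  rw [bc, qchoose_eq_choose, Ring.choose_natCast, Nat.choose_eq_zero_of_lt h]; simp

theorem bc_zero_succ (j : ℕ) : bc 0 (j + 1) = 0 := by
  have := bc_natCast_of_lt (t := 0) (m := j + 1) (by omega)
  simpa using this

/-- Trinomial revision with a shifted upper index, combined with the Vandermonde identity. -/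
theorem sum_bc_mul_bc (A α : ℚ) (k j : ℕ) :
    ∑ i ∈ Finset.range (j + 1), bc A (j - i) * bc (-((k + 1 : ℕ) : ℚ)) i * bc (α + i) (k + i)
      = bc (A - α - 1) j * bc α k := by
  have key : ∀ i : ℕ, bc (-((k + 1 : ℕ) : ℚ)) i * bc (α + i) (k + i)
      = bc (-(α + 1)) i * bc α k := by
    intro i
    have h2 := bc_mul_bc (α + i) i k
    rw [add_comm i k] at h2
    rw [bc_neg, bc_neg]
    rw [show ((k + 1 : ℕ) : ℚ) + i - 1 = ((k + i : ℕ) : ℚ) by push_cast; ring,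
      show α + 1 + i - 1 = α + i by ring]
    rw [show α + i - i = α by ring] at h2
    linear_combination (-1) ^ i * h2
  rw [show A - α - 1 = -(α + 1) + A by ring, bc_add, Finset.sum_mul]
  refine Finset.sum_congr rfl fun i _ => ?_
  rw [mul_assoc, key]; ring

end Binomials

section Residues

section Sequences

variable {W W' : Type} [AddCommGroup W] [Module ℂ W] [AddCommGroup W'] [Module ℂ W']

/-- `fres f α β = ∑_{j ≥ 0} binom(α, j) f (j - β)`. -/
def fres (f : ℤ → W) (α : ℚ) (β : ℤ) : W := ∑ᶠ j : ℕ, bc α j • f ((j : ℤ) - β)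

theorem fres_eq_sum {f : ℤ → W} {N : ℤ} (hN : ∀ m, N ≤ m → f m = 0) (α : ℚ) {β : ℤ} {M : ℕ}
    (hM : N ≤ M - β) : fres f α β = ∑ j ∈ Finset.range M, bc α j • f ((j : ℤ) - β) := by
  refine finsum_eq_sum_of_support_subset _ fun j hj => ?_
  simp only [Finset.coe_range, Set.mem_Iio]
  by_contra h
  refine hj ?_
  show bc α j • f ((j : ℤ) - β) = 0
  rw [hN _ (by omega), smul_zero]

theorem fres_eq_sum_eventually {f : ℤ → W} (hf : ∃ N : ℤ, ∀ m, N ≤ m → f m = 0) (α : ℚ) (β : ℤ) :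
    ∀ᶠ M : ℕ in Filter.atTop,
      fres f α β = ∑ j ∈ Finset.range M, bc α j • f ((j : ℤ) - β) := by
  obtain ⟨N, hN⟩ := hf
  filter_upwards [Filter.eventually_ge_atTop (N + β).toNat] with M hM
  exact fres_eq_sum hN α (by omega)

theorem fres_map (φ : W →ₗ[ℂ] W') {f : ℤ → W} (hf : ∃ N : ℤ, ∀ m, N ≤ m → f m = 0)
    (α : ℚ) (β : ℤ) : φ (fres f α β) = fres (fun m => φ (f m)) α β := by
  obtain ⟨N, hN⟩ := hf
  rw [fres_eq_sum hN α (M := (N + β).toNat) (by omega),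
    fres_eq_sum (f := fun m => φ (f m)) (N := N) (fun m hm => by rw [hN m hm, map_zero]) α
      (M := (N + β).toNat) (by omega), map_sum]
  simp only [map_smul]

theorem fres_add {f f' : ℤ → W} (hf : ∃ N : ℤ, ∀ m, N ≤ m → f m = 0)
    (hf' : ∃ N : ℤ, ∀ m, N ≤ m → f' m = 0) (α : ℚ) (β : ℤ) :
    fres (fun m => f m + f' m) α β = fres f α β + fres f' α β := by
  have h3 : ∃ N : ℤ, ∀ m, N ≤ m → f m + f' m = 0 := by
    obtain ⟨N, hN⟩ := hf
    obtain ⟨N', hN'⟩ := hf'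
    exact ⟨max N N', fun m hm => by
      rw [hN m (le_trans (le_max_left _ _) hm), hN' m (le_trans (le_max_right _ _) hm), add_zero]⟩
  obtain ⟨M, h1, h2, h3⟩ := ((fres_eq_sum_eventually hf α β).and
    ((fres_eq_sum_eventually hf' α β).and (fres_eq_sum_eventually h3 α β))).exists
  rw [h1, h2, h3, ← Finset.sum_add_distrib]
  simp only [smul_add]

theorem fres_smul (c : ℂ) {f : ℤ → W} (hf : ∃ N : ℤ, ∀ m, N ≤ m → f m = 0) (α : ℚ) (β : ℤ) :
    fres (fun m => c • f m) α β = c • fres f α β :=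
  (fres_map (c • LinearMap.id : W →ₗ[ℂ] W) hf α β).symm

theorem fres_pascal {f : ℤ → W} (hf : ∃ N : ℤ, ∀ m, N ≤ m → f m = 0) (α : ℚ) (β : ℤ) :
    fres f (α + 1) β = fres f α β + fres f α (β - 1) := by
  obtain ⟨N, hN⟩ := hf
  set M := (N + β).toNat
  rw [fres_eq_sum hN (α + 1) (M := M + 1) (by omega), fres_eq_sum hN α (M := M + 1) (by omega),
    fres_eq_sum hN α (M := M) (by omega), Finset.sum_range_succ', Finset.sum_range_succ' _ M]
  simp only [bc_pascal, bc_zero, add_smul, Finset.sum_add_distrib]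
  rw [add_right_comm]
  congr 1
  refine Finset.sum_congr rfl fun j _ => ?_
  congr 2
  push_cast; ring

theorem fres_derivative {f : ℤ → W} (hf : ∃ N : ℤ, ∀ m, N ≤ m → f m = 0) (α : ℚ) (β : ℤ) :
    fres (fun m => (-(m : ℂ)) • f (m - 1)) (α + 1) β
      = (-((α : ℂ) + 1)) • fres f α β + (β : ℂ) • fres f (α + 1) (β + 1) := by
  obtain ⟨N, hN⟩ := hf
  set M := (N + β).toNat
  rw [fres_eq_sum (N := N + 1) (M := M + 1) (fun m hm => by rw [hN _ (by omega), smul_zero]) _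
      (by omega), fres_eq_sum hN (α + 1) (M := M + 1) (by omega), fres_eq_sum hN α (M := M)
      (by omega), Finset.smul_sum, Finset.smul_sum]
  have h : ∀ j : ℕ, bc (α + 1) j • (-(((j : ℤ) - β : ℤ) : ℂ)) • f ((j : ℤ) - β - 1)
      = (-((j : ℂ) * bc (α + 1) j)) • f ((j : ℤ) - β - 1)
        + (β : ℂ) • bc (α + 1) j • f ((j : ℤ) - (β + 1)) := by
    intro j
    rw [sub_sub, smul_smul, smul_smul, ← add_smul]
    congr 1
    push_cast; ring
  simp only [h, Finset.sum_add_distrib]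
  congr 1
  rw [Finset.sum_range_succ']
  simp only [Nat.cast_zero, zero_mul, neg_zero, zero_smul, add_zero]
  refine Finset.sum_congr rfl fun j _ => ?_
  rw [smul_smul, Nat.cast_succ, bc_add_one_succ]
  congr 2
  · ring
  · push_cast; ring

theorem fres_vandermonde {f : ℤ → W} {N : ℤ} (hN : ∀ m, N ≤ m → f m = 0) (B G : ℚ) {L : ℤ} {M : ℕ}
    (hM : N ≤ M - L) :
    ∑ t ∈ Finset.range M, bc B t • fres f G (L - t) = fres f (B + G) L := by
  rw [fres_eq_sum hN _ hM]
  have h1 : ∀ t ∈ Finset.range M, bc B t • fres f G (L - t) =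
      ∑ j ∈ Finset.range (M - t), bc B t • bc G j • f (((t + j : ℕ) : ℤ) - L) := by
    intro t ht
    have := Finset.mem_range.1 ht
    rw [fres_eq_sum hN G (M := M - t) (by omega), Finset.smul_sum]
    refine Finset.sum_congr rfl fun j _ => ?_
    congr 3
    push_cast; ring
  rw [Finset.sum_congr rfl h1, ← Finset.sum_range_diag_flip M
    (fun t j => bc B t • bc G j • f (((t + j : ℕ) : ℤ) - L))]
  refine Finset.sum_congr rfl fun n _ => ?_
  rw [bc_add, Finset.sum_smul]
  refine Finset.sum_congr rfl fun t ht => ?_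
  have := Finset.mem_range.1 ht
  rw [smul_smul, show t + (n - t) = n by omega]

theorem fres_vandermonde_shift {f : ℤ → W} {N : ℤ} (hN : ∀ m, N ≤ m → f m = 0) (A G : ℚ) (m : ℕ)
    {L : ℤ} {M : ℕ} (hM : N ≤ M - L) (hmM : m ≤ M) :
    ∑ t ∈ Finset.range M, (bc A t * bc (t : ℚ) m) • fres f G (L - t)
      = bc A m • fres f (A - m + G) (L - m) := by
  obtain ⟨M', rfl⟩ := Nat.exists_eq_add_of_le hmM
  rw [Finset.sum_range_add, Finset.sum_eq_zero, zero_add,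
    ← fres_vandermonde hN (A - m) G (M := M') (by push_cast at hM; omega), Finset.smul_sum]
  · refine Finset.sum_congr rfl fun t _ => ?_
    rw [bc_mul_bc, smul_smul]
    congr 2
    push_cast; ring
  · intro t ht
    rw [bc_natCast_of_lt (Finset.mem_range.1 ht), mul_zero, zero_smul]

end Sequences

variable (V : VOA)

theorem VOA.res_eq_fres (α : ℚ) (β : ℤ) (u v : V.carrier) :
    V.res α β u v = fres (fun m => V.mode u m v) α β := rfl

theorem VOA.res_add_left (α : ℚ) (β : ℤ) (u u' v : V.carrier) :
    V.res α β (u + u') v = V.res α β u v + V.res α β u' v := by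
  rw [V.res_eq_fres, V.res_eq_fres, V.res_eq_fres, ← fres_add (V.trunc u v) (V.trunc u' v)]
  simp

theorem VOA.res_add_right (α : ℚ) (β : ℤ) (u v v' : V.carrier) :
    V.res α β u (v + v') = V.res α β u v + V.res α β u v' := by
  rw [V.res_eq_fres, V.res_eq_fres, V.res_eq_fres, ← fres_add (V.trunc u v) (V.trunc u v')]
  simp

theorem VOA.res_smul_left (α : ℚ) (β : ℤ) (c : ℂ) (u v : V.carrier) :
    V.res α β (c • u) v = c • V.res α β u v := by
  rw [V.res_eq_fres, V.res_eq_fres, ← fres_smul c (V.trunc u v)]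
  simp

theorem VOA.res_smul_right (α : ℚ) (β : ℤ) (c : ℂ) (u v : V.carrier) :
    V.res α β u (c • v) = c • V.res α β u v := by
  rw [V.res_eq_fres, V.res_eq_fres, ← fres_smul c (V.trunc u v)]
  simp

/-- `V.res α β` as a bilinear map. -/
def VOA.resL (α : ℚ) (β : ℤ) : V.carrier →ₗ[ℂ] V.carrier →ₗ[ℂ] V.carrier :=
  LinearMap.mk₂ ℂ (V.res α β) (fun u u' v => V.res_add_left α β u u' v)
    (fun c u v => V.res_smul_left α β c u v) (fun u v v' => V.res_add_right α β u v v')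
    (fun c u v => V.res_smul_right α β c u v)

@[simp] theorem VOA.resL_apply (α : ℚ) (β : ℤ) (u v : V.carrier) :
    V.resL α β u v = V.res α β u v := rfl

theorem VOA.res_pascal (α : ℚ) (β : ℤ) (u v : V.carrier) :
    V.res (α + 1) β u v = V.res α β u v + V.res α (β - 1) u v :=
  fres_pascal (V.trunc u v) α β

theorem VOA.res_translation (α : ℚ) (β : ℤ) (u v : V.carrier) :
    V.res (α + 1) β (V.mode V.conformal 0 u) v
      = (-((α : ℂ) + 1)) • V.res α β u v + (β : ℂ) • V.res (α + 1) (β + 1) u v := by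
  rw [V.res_eq_fres, V.res_eq_fres, V.res_eq_fres, ← fres_derivative (V.trunc u v)]
  congr 1
  funext m
  rw [V.Lneg1_mode, LinearMap.smul_apply]

theorem VOA.map_res (φ : V.carrier →ₗ[ℂ] V.carrier) (α : ℚ) (β : ℤ) (u v : V.carrier) :
    φ (V.res α β u v) = fres (fun m => φ (V.mode u m v)) α β :=
  fres_map φ (V.trunc u v) α β

theorem VOA.exists_nat_trunc (u v : V.carrier) : ∃ J : ℕ, ∀ j : ℕ, J ≤ j → V.mode u j v = 0 := by
  obtain ⟨N, hN⟩ := V.trunc u v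
  exact ⟨N.toNat, fun j hj => hN _ (by omega)⟩

theorem VOA.commutator (u c d : V.carrier) {J : ℕ} (hJ : ∀ j : ℕ, J ≤ j → V.mode u j c = 0)
    (p q : ℤ) :
    V.mode u p (V.mode c q d) - V.mode c q (V.mode u p d)
      = ∑ j ∈ Finset.range J, bc p j • V.mode (V.mode u j c) (p + q - j) d := by
  have h := V.borcherds u c d p q 0
  rw [finsum_eq_sum_of_support_subset (s := Finset.range J), finsum_eq_single _ 0] at h
  · simpa [qchoose_zero, bc] using h.symm
  · intro j hj
    obtain ⟨j, rfl⟩ := Nat.exists_eq_succ_of_ne_zero hj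
    have := bc_zero_succ j
    simp only [bc] at this
    simp [this]
  · intro j hj
    simp only [Finset.coe_range, Set.mem_Iio]
    by_contra hc
    refine hj ?_
    simp [hJ j (by omega)]

/-- The commutator formula for generating functions of modes. -/
theorem VOA.res_commutator (u c d : V.carrier) {J : ℕ} (hJ : ∀ j : ℕ, J ≤ j → V.mode u j c = 0)
    (A G : ℚ) (k K : ℤ) :
    V.res A k u (V.res G K c d) - V.res G K c (V.res A k u d)
      = ∑ j ∈ Finset.range J, ∑ i ∈ Finset.range (j + 1),
        (bc A (j - i) * bc (-k) i) •
          V.res (A + G - j + i) (k + i + K) (V.mode u j c) d := by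
  choose N hN using fun j : ℕ => V.trunc (V.mode u j c) d
  obtain ⟨M, h1, h2, h3, h4, hM⟩ := ((fres_eq_sum_eventually (V.trunc u (V.res G K c d)) A k).and
    ((fres_eq_sum_eventually (V.trunc c d) G K).and
    ((fres_eq_sum_eventually (V.trunc u d) A k).and
    ((fres_eq_sum_eventually (V.trunc c (V.res A k u d)) G K).and
    (Filter.eventually_ge_atTop
      (J + ∑ j ∈ Finset.range J, (N j).toNat + K.toNat + k.toNat + J)))))).exists
  have hNM : ∀ j < J, N j ≤ M - (K + k + j) := by
    intro j hj
    have := Finset.single_le_sum (f := fun j => (N j).toNat) (fun _ _ => Nat.zero_le _)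
      (Finset.mem_range.2 hj)
    omega
  have e1 : V.res A k u (V.res G K c d) = ∑ t ∈ Finset.range M, ∑ n ∈ Finset.range M,
      (bc A t * bc G n) • V.mode u (t - k) (V.mode c (n - K) d) := by
    rw [V.res_eq_fres A k, h1]
    refine Finset.sum_congr rfl fun t _ => ?_
    rw [V.res_eq_fres, h2, map_sum, Finset.smul_sum]
    simp only [map_smul, smul_smul]
  have e2 : V.res G K c (V.res A k u d) = ∑ t ∈ Finset.range M, ∑ n ∈ Finset.range M,
      (bc A t * bc G n) • V.mode c (n - K) (V.mode u (t - k) d) := by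
    rw [V.res_eq_fres G K, h4, Finset.sum_comm]
    refine Finset.sum_congr rfl fun t _ => ?_
    rw [V.res_eq_fres, h3, map_sum, Finset.smul_sum]
    simp only [map_smul, smul_smul, mul_comm]
  rw [e1, e2, ← Finset.sum_sub_distrib]
  simp only [← Finset.sum_sub_distrib, ← smul_sub, V.commutator u c d hJ]
  have e3 : ∀ t ∈ Finset.range M, ∑ n ∈ Finset.range M, (bc A t * bc G n) •
        ∑ j ∈ Finset.range J, bc ((((t : ℤ) - k : ℤ)) : ℚ) j •
          V.mode (V.mode u j c) ((t : ℤ) - k + (n - K) - j) d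
      = ∑ j ∈ Finset.range J, ∑ i ∈ Finset.range (j + 1), (bc (-k) i * (bc A t * bc t (j - i))) •
          V.res G (K + k + j - t) (V.mode u j c) d := by
    intro t _
    simp only [Finset.smul_sum]
    rw [Finset.sum_comm]
    refine Finset.sum_congr rfl fun j hj => ?_
    have hj' := hNM j (Finset.mem_range.1 hj)
    rw [← Finset.sum_smul, V.res_eq_fres, fres_eq_sum (hN j) G (M := M) (by omega),
      Finset.smul_sum]
    refine Finset.sum_congr rfl fun n _ => ?_
    rw [smul_smul, smul_smul, show (n : ℤ) - (K + k + j - t) = (t : ℤ) - k + (n - K) - j by ring]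
    congr 1
    have := bc_add (-k) t j
    rw [show (((t : ℤ) - k : ℤ) : ℚ) = -k + t by push_cast; ring, this, Finset.mul_sum,
      Finset.sum_mul]
    refine Finset.sum_congr rfl fun i _ => ?_
    ring
  rw [Finset.sum_congr rfl e3, Finset.sum_comm]
  refine Finset.sum_congr rfl fun j hj => ?_
  have hj' := hNM j (Finset.mem_range.1 hj)
  have hj2 := Finset.mem_range.1 hj
  rw [Finset.sum_comm]
  refine Finset.sum_congr rfl fun i hi => ?_
  have hi' := Finset.mem_range.1 hi
  simp only [mul_smul (bc (-k) i)]
  rw [← Finset.smul_sum]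
  simp only [V.res_eq_fres]
  rw [fres_vandermonde_shift (hN j) A G (j - i) hj' (by omega), smul_smul, mul_comm]
  congr 2
  · rw [Nat.cast_sub (by omega)]; ring
  · rw [Nat.cast_sub (by omega)]; ring

end Residues

section SkewSymmetry

theorem sum_neg_one_pow_mul_bc (B β : ℚ) (n : ℕ) :
    ∑ t ∈ Finset.range (n + 1), (-1) ^ t * bc β t * bc (B - t) (n - t) = bc (B - β) n := by
  rw [show B - β = -(β + (n - 1 - B) - (n - 1)) by ring, bc_neg,
    show β + ((n : ℚ) - 1 - B) - (n - 1) + n - 1 = β + (n - 1 - B) by ring, bc_add, Finset.mul_sum]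
  refine Finset.sum_congr rfl fun t ht => ?_
  have ht := Finset.mem_range.1 ht
  rw [show B - t = -(t - B) by ring, bc_neg,
    show (t : ℚ) - B + ((n - t : ℕ) : ℚ) - 1 = n - 1 - B by rw [Nat.cast_sub (by omega)]; ring]
  have : (-1 : ℂ) ^ n = (-1) ^ t * (-1) ^ (n - t) := by
    rw [← pow_add]; congr 1; omega
  rw [this]; ring

variable (V : VOA)

/-- The operator `L(-1) + L(0)`. -/
def VOA.D : V.carrier →ₗ[ℂ] V.carrier := V.mode V.conformal 0 + V.mode V.conformal 1

theorem VOA.D_apply (u : V.carrier) :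
    V.D u = V.mode V.conformal 0 u + V.mode V.conformal 1 u := rfl

variable {V}

theorem VOA.conformal_zero_mode (u v : V.carrier) (m : ℤ) :
    V.mode V.conformal 0 (V.mode u m v) =
      V.mode u m (V.mode V.conformal 0 v) - (m : ℂ) • V.mode u (m - 1) v := by
  obtain ⟨J, hJ⟩ := V.exists_nat_trunc V.conformal u
  have h := V.commutator V.conformal u v (J := J + 1) (fun j hj => hJ j (by omega)) 0 m
  rw [Finset.sum_range_succ', Finset.sum_eq_zero, zero_add] at h
  · rw [Nat.cast_zero, bc_zero, one_smul, V.Lneg1_mode, LinearMap.smul_apply, sub_eq_iff_eq_add] at h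
    rw [h]
    simp only [zero_add, sub_zero, neg_smul]
    abel
  · intro j _
    rw [Int.cast_zero, bc_zero_succ, zero_smul]

theorem VOA.conformal_one_mode {a : ℤ} {u : V.carrier} (hu : u ∈ V.wtSpace a) (v : V.carrier)
    (m : ℤ) :
    V.mode V.conformal 1 (V.mode u m v) =
      V.mode u m (V.mode V.conformal 1 v) + ((a : ℂ) - 1 - m) • V.mode u m v := by
  obtain ⟨J, hJ⟩ := V.exists_nat_trunc V.conformal u
  have h := V.commutator V.conformal u v (J := J + 2) (fun j hj => hJ j (by omega)) 1 m
  rw [Finset.sum_range_succ', Finset.sum_range_succ', Finset.sum_eq_zero, zero_add] at h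
  · simp only [zero_add, Nat.cast_zero, Nat.cast_one, bc_zero, bc_one, one_smul, Int.cast_one,
      Rat.cast_one, V.L0_grading a u hu, V.Lneg1_mode, sub_zero] at h
    rw [sub_eq_iff_eq_add] at h
    rw [h]
    simp only [map_smul, LinearMap.smul_apply, Pi.smul_apply, add_sub_cancel_left]
    push_cast
    module
  · intro j _
    have := bc_natCast_of_lt (t := 1) (m := j + 1 + 1) (by omega)
    rw [Nat.cast_one] at this
    rw [Int.cast_one, this, zero_smul]

theorem VOA.D_mode {a : ℤ} {u : V.carrier} (hu : u ∈ V.wtSpace a) (v : V.carrier) (m : ℤ) :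
    V.D (V.mode u m v) = V.mode u m (V.D v) + (-(m : ℂ)) • V.mode u (m - 1) v
      + ((a : ℂ) - 1) • V.mode u m v + (-(m : ℂ)) • V.mode u m v := by
  rw [V.D_apply, V.D_apply, VOA.conformal_zero_mode, VOA.conformal_one_mode hu, map_add]
  module

theorem VOA.res_D {a : ℤ} {u : V.carrier} (hu : u ∈ V.wtSpace a) (α : ℚ) (β : ℤ) (w : V.carrier) :
    V.res α β u (V.D w) = V.D (V.res α β u w) + ((α : ℂ) + 1 - a) • V.res α β u w
      - (β : ℂ) • V.res (α + 1) (β + 1) u w := by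
  have t0 := V.trunc u w
  have t1 : ∃ N : ℤ, ∀ m, N ≤ m → (-(m : ℂ)) • V.mode u (m - 1) w = 0 := by
    obtain ⟨N, hN⟩ := t0
    exact ⟨N + 1, fun m hm => by rw [hN _ (by omega), smul_zero]⟩
  have t2 : ∃ N : ℤ, ∀ m, N ≤ m → ((a : ℂ) - 1) • V.mode u m w = 0 := by
    obtain ⟨N, hN⟩ := t0
    exact ⟨N, fun m hm => by rw [hN _ (by omega), smul_zero]⟩
  have t3 : ∃ N : ℤ, ∀ m, N ≤ m → (-(m : ℂ)) • V.mode u m w = 0 := by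
    obtain ⟨N, hN⟩ := t0
    exact ⟨N, fun m hm => by rw [hN _ (by omega), smul_zero]⟩
  have t4 : ∃ N : ℤ, ∀ m, N ≤ m → V.mode u (m + 1) w = 0 := by
    obtain ⟨N, hN⟩ := t0
    exact ⟨N, fun m hm => by rw [hN _ (by omega)]⟩
  have t5 : ∃ N : ℤ, ∀ m, N ≤ m → V.mode u m (V.D w) + (-(m : ℂ)) • V.mode u (m - 1) w = 0 := by
    obtain ⟨N, hN⟩ := V.trunc u (V.D w)
    obtain ⟨N', hN'⟩ := t1
    exact ⟨max N N', fun m hm => by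
      rw [hN m (le_trans (le_max_left _ _) hm), hN' m (le_trans (le_max_right _ _) hm), add_zero]⟩
  have t6 : ∃ N : ℤ, ∀ m, N ≤ m → V.mode u m (V.D w) + (-(m : ℂ)) • V.mode u (m - 1) w
      + ((a : ℂ) - 1) • V.mode u m w = 0 := by
    obtain ⟨N, hN⟩ := t5
    obtain ⟨N', hN'⟩ := t2
    exact ⟨max N N', fun m hm => by
      rw [hN m (le_trans (le_max_left _ _) hm), hN' m (le_trans (le_max_right _ _) hm), add_zero]⟩
  rw [V.map_res]
  simp only [VOA.D_mode hu]
  rw [fres_add t6 t3, fres_add t5 t2, fres_add (V.trunc u (V.D w)) t1, fres_smul _ t0,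
    ← V.res_eq_fres, ← V.res_eq_fres]
  have e1 := fres_derivative t0 (α - 1) β
  have e2 := fres_derivative t4 (α - 1) β
  have e3 := V.res_pascal (α - 1) β u w
  have e4 := V.res_pascal α (β + 1) u w
  have s1 : fres (fun m => V.mode u (m + 1) w) (α - 1) β = V.res (α - 1) (β - 1) u w := by
    rw [V.res_eq_fres]
    simp only [fres]
    refine finsum_congr fun j => ?_
    rw [show (j : ℤ) - β + 1 = j - (β - 1) by ring]
  have s2 : fres (fun m => V.mode u (m + 1) w) α (β + 1) = V.res α β u w := by
    rw [V.res_eq_fres]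
    simp only [fres]
    refine finsum_congr fun j => ?_
    rw [show (j : ℤ) - (β + 1) + 1 = j - β by ring]
  simp only [sub_add_cancel, add_sub_cancel_right] at e1 e2 e3 e4
  rw [s1, s2] at e2
  rw [e1, e2, ← V.res_eq_fres, ← V.res_eq_fres, e4, e3]
  push_cast
  module

theorem VOA.mode_neg_vacuum_sub_mem {w : ℤ} {y : V.carrier} (hy : y ∈ V.wtSpace w) (j : ℕ) :
    V.mode y (-1 - j) V.vacuum - bc (-w) j • y ∈ LinearMap.range V.D := by
  induction j generalizing w y with
  | zero => simp [V.creation₁, bc_zero]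
  | succ j ih =>
    have hy' : V.mode V.conformal 0 y ∈ V.wtSpace (w + 1) := by
      have := V.mode_grading 2 w 0 _ _ V.conformal_wt hy
      rwa [show 2 + w - 0 - 1 = w + 1 by ring] at this
    have h1 := ih hy'
    rw [V.Lneg1_mode, LinearMap.smul_apply] at h1
    have h2 : V.D y ∈ LinearMap.range V.D := ⟨y, rfl⟩
    rw [V.D_apply, V.L0_grading w y hy] at h2
    have h3 := bc_add_one_succ (-w - 1) j
    have hne : ((j : ℂ) + 1) ≠ 0 := Nat.cast_add_one_ne_zero j
    rw [← Submodule.smul_mem_iff _ hne]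
    have h4 := Submodule.add_mem _ h1 (Submodule.smul_mem _ (bc (-w - 1) j) h2)
    convert h4 using 1
    rw [sub_add_cancel] at h3
    rw [smul_sub, smul_smul, h3,
      show (-1 - ((j + 1 : ℕ) : ℤ)) = -1 - j - 1 by push_cast; ring,
      show (-(((w + 1 : ℤ)) : ℚ)) = -w - 1 by push_cast; ring]
    push_cast
    module

theorem VOA.mode_skew {a b : ℤ} {u v : V.carrier} (hu : u ∈ V.wtSpace a) (hv : v ∈ V.wtSpace b)
    (s : ℤ) :
    V.mode v s u - (-1 : ℂ) ^ (s + 1) • V.res (a + b - s - 2) (-s) u v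
      ∈ LinearMap.range V.D := by
  obtain ⟨N, hN⟩ := V.trunc u v
  have hB := V.borcherds u v V.vacuum (-1) 0 s
  have hM := fres_eq_sum hN (a + b - s - 2) (β := -s) (M := (N - s).toNat) (by omega)
  rw [finsum_eq_sum_of_support_subset (s := Finset.range (N - s).toNat),
    finsum_eq_single _ 0] at hB
  · have h0 : ∀ j : ℕ, V.mode (V.mode u (s + j) v) (-1 + 0 - j) V.vacuum
        - bc (-(a + b - (s + j) - 1)) j • V.mode u (s + j) v ∈ LinearMap.range V.D := by
      intro j
      have := VOA.mode_neg_vacuum_sub_mem (V.mode_grading a b (s + j) u v hu hv) j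
      convert this using 4
      · ring
      · push_cast; ring
    have h1 := Submodule.sum_mem _ fun j (_ : j ∈ Finset.range (N - s).toNat) =>
      Submodule.smul_mem _ (bc (-1) j) (h0 j)
    simp only [smul_sub, Finset.sum_sub_distrib] at h1
    have hB' : ∑ j ∈ Finset.range (N - s).toNat, bc (-1) j •
        V.mode (V.mode u (s + j) v) (-1 + 0 - j) V.vacuum = -((-1 : ℂ) ^ s • V.mode v s u) := by
      simpa [bc, qchoose_zero, V.creation₁, V.creation₂ v 0 le_rfl] using hB
    rw [hB'] at h1
    have hc : ∀ j : ℕ, bc (-1) j * bc (-(a + b - (s + j) - 1)) j = bc (a + b - s - 2) j := by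
      intro j
      rw [show (-1 : ℚ) = -(1 : ℚ) by rfl, bc_neg, bc_neg, add_sub_cancel_left]
      have : bc (j : ℚ) j = 1 := by
        rw [bc, qchoose_eq_choose, Ring.choose_natCast]; simp
      rw [this, show (a : ℚ) + b - (s + j) - 1 + j - 1 = a + b - s - 2 by ring,
        mul_one, ← mul_assoc, ← mul_pow]
      simp
    simp only [smul_smul, hc] at h1
    have h2 : V.res (a + b - s - 2) (-s) u v = ∑ j ∈ Finset.range (N - s).toNat,
        bc (a + b - s - 2) j • V.mode u (s + j) v := by
      rw [V.res_eq_fres, hM]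
      refine Finset.sum_congr rfl fun j _ => ?_
      rw [show (j : ℤ) - -s = s + j by ring]
    rw [← h2] at h1
    have h3 := Submodule.smul_mem _ (-(-1 : ℂ) ^ s) h1
    convert h3 using 1
    have h4 : (-1 : ℂ) ^ s * (-1 : ℂ) ^ s = 1 := by
      rw [← mul_zpow]; simp
    rw [smul_sub, smul_neg, smul_smul, zpow_add₀ (by norm_num), neg_mul, h4]
    module
  · intro j hj
    have hj1 : V.mode v j V.vacuum = 0 := V.creation₂ _ _ (by omega)
    have hj2 : V.mode u (-1 + (j : ℤ)) V.vacuum = 0 := V.creation₂ _ _ (by omega)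
    simp [hj1, hj2]
  · intro j hj
    simp only [Finset.coe_range, Set.mem_Iio]
    by_contra hc
    refine hj ?_
    simp [hN (s + j) (by omega)]

theorem VOA.res_skew {a b : ℤ} {u v : V.carrier} (hu : u ∈ V.wtSpace a) (hv : v ∈ V.wtSpace b)
    (β : ℚ) (γ : ℤ) :
    V.res β γ v u - (-1 : ℂ) ^ (γ + 1) • V.res (a + b + γ - β - 2) γ u v
      ∈ LinearMap.range V.D := by
  obtain ⟨N, hN⟩ := V.trunc u v
  obtain ⟨N', hN'⟩ := V.trunc v u
  set M := (max N N' + γ).toNat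
  have hm1 := le_max_left N N'
  have hm2 := le_max_right N N'
  have h1 := Submodule.sum_mem (LinearMap.range V.D) fun t (_ : t ∈ Finset.range M) =>
    Submodule.smul_mem _ (bc β t) (VOA.mode_skew hu hv ((t : ℤ) - γ))
  simp only [smul_sub, Finset.sum_sub_distrib] at h1
  rw [← fres_eq_sum hN' β (M := M) (by omega), ← V.res_eq_fres] at h1
  convert h1 using 2
  rw [V.res_eq_fres, fres_eq_sum hN _ (M := M) (by omega), Finset.smul_sum]
  have h2 : ∀ t ∈ Finset.range M,
      bc β t • (-1 : ℂ) ^ ((t : ℤ) - γ + 1) • V.res (a + b - ((t : ℤ) - γ : ℤ) - 2) (-(t - γ)) u v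
      = ∑ j ∈ Finset.range (M - t), ((-1 : ℂ) ^ (γ + 1) * ((-1) ^ t * bc β t *
          bc (a + b + γ - 2 - t) j)) • V.mode u (((t + j : ℕ) : ℤ) - γ) v := by
    intro t ht
    have ht := Finset.mem_range.1 ht
    rw [V.res_eq_fres, fres_eq_sum hN _ (M := M - t) (by omega), Finset.smul_sum, Finset.smul_sum]
    refine Finset.sum_congr rfl fun j _ => ?_
    rw [smul_smul, smul_smul, show (j : ℤ) - -(t - γ) = ((t + j : ℕ) : ℤ) - γ by push_cast; ring,
      show (a : ℚ) + b - ((t : ℤ) - γ : ℤ) - 2 = a + b + γ - 2 - t by push_cast; ring,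
      show (t : ℤ) - γ + 1 = (γ + 1) + t - 2 * γ by ring,
      zpow_sub₀ (by norm_num), zpow_add₀ (by norm_num), zpow_mul, zpow_natCast]
    norm_num
    congr 1; ring
  rw [Finset.sum_congr rfl h2, ← Finset.sum_range_diag_flip M (fun t j =>
    ((-1 : ℂ) ^ (γ + 1) * ((-1) ^ t * bc β t * bc (a + b + γ - 2 - t) j)) •
      V.mode u (((t + j : ℕ) : ℤ) - γ) v)]
  refine Finset.sum_congr rfl fun n _ => ?_
  rw [show (a : ℚ) + b + γ - β - 2 = a + b + γ - 2 - β by ring, ← sum_neg_one_pow_mul_bc,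
    Finset.sum_smul, Finset.smul_sum]
  refine Finset.sum_congr rfl fun t ht => ?_
  have := Finset.mem_range.1 ht
  rw [smul_smul, show t + (n - t) = n by omega]

end SkewSymmetry

section Eigenspaces

variable {V : VOA}

/-- Raising the order of the pole, and then the power of `1 + z`, in a family of residues. -/
theorem VOA.res_mem_of_generators {O E : Submodule ℂ V.carrier}
    (hE : ∀ u ∈ E, V.mode V.conformal 0 u ∈ E) {σ : ℚ} {b : ℤ} (hb : 0 < b)
    (h : ∀ (k : ℤ) (u v : V.carrier), u ∈ V.wtSpace k → u ∈ E → V.res (k + σ) b u v ∈ O)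
    (K : ℕ) {s : ℕ} (hs : s ≤ K) {k : ℤ} {u : V.carrier} (hu : u ∈ V.wtSpace k) (huE : u ∈ E)
    (v : V.carrier) : V.res (k + σ + s) (b + K) u v ∈ O := by
  induction K generalizing s k u with
  | zero =>
    obtain rfl : s = 0 := by omega
    simpa using h k u v hu huE
  | succ K ih =>
    have hu' : V.mode V.conformal 0 u ∈ V.wtSpace (k + 1) := by
      have := V.mode_grading 2 k 0 _ _ V.conformal_wt hu
      rwa [show 2 + k - 0 - 1 = k + 1 by ring] at this
    induction s with
    | zero =>
      have h1 := ih (Nat.zero_le K) hu' (hE u huE)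
      have h2 := ih (Nat.zero_le K) hu huE
      have h3 := V.res_pascal (k + σ) (b + (K + 1 : ℕ)) u v
      have h4 := V.res_translation (k + σ) (b + K) u v
      simp only [Nat.cast_zero, add_zero] at h1 h2 ⊢
      rw [show (((k + 1 : ℤ) : ℚ) + σ) = k + σ + 1 by push_cast; ring, h4] at h1
      have h5 := (Submodule.add_mem_iff_right _ (Submodule.smul_mem _ _ h2)).1 h1
      rw [Submodule.smul_mem_iff _ (by exact_mod_cast (by omega : b + (K : ℤ) ≠ 0))] at h5
      rw [show b + ((K + 1 : ℕ) : ℤ) - 1 = b + K by push_cast; ring] at h3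
      rw [show b + ((K : ℕ) : ℤ) + 1 = b + (K + 1 : ℕ) by push_cast; ring, h3] at h5
      exact (Submodule.add_mem_iff_left _ h2).1 h5
    | succ s ihs =>
      have h3 := V.res_pascal (k + σ + s) (b + (K + 1 : ℕ)) u v
      rw [show b + ((K + 1 : ℕ) : ℤ) - 1 = b + K by push_cast; ring] at h3
      rw [show k + σ + ((s + 1 : ℕ) : ℚ) = k + σ + s + 1 by push_cast; ring, h3]
      exact Submodule.add_mem _ (ihs (by omega)) (ih (by omega) hu huE)

theorem VOA.res_res_mem_of_generators {O E : Submodule ℂ V.carrier}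
    (hE : ∀ u ∈ E, V.mode V.conformal 0 u ∈ E) {σ : ℚ} {b : ℤ} (hb : 0 < b)
    (h : ∀ (k : ℤ) (u v : V.carrier), u ∈ V.wtSpace k → u ∈ E → V.res (k + σ) b u v ∈ O)
    {a p : ℤ} {u c : V.carrier} (hu : u ∈ V.wtSpace a) (huE : ∀ m, V.mode u m c ∈ E)
    (hc : c ∈ V.wtSpace p) (hcE : c ∈ E) (d : V.carrier) {s k : ℕ} (hs : s ≤ k) :
    V.res (a - 1 + s) k u (V.res (p + σ) b c d) ∈ O := by
  obtain ⟨J, hJ⟩ := V.exists_nat_trunc u c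
  rw [← sub_add_cancel (V.res (a - 1 + s) k u (V.res (p + σ) b c d))
    (V.res (p + σ) b c (V.res (a - 1 + s) k u d)), V.res_commutator u c d hJ]
  refine Submodule.add_mem _ (Submodule.sum_mem _ fun j _ => Submodule.sum_mem _ fun i _ =>
    Submodule.smul_mem _ _ ?_) (h _ _ _ hc hcE)
  have := VOA.res_mem_of_generators hE hb h (k + i) (s := s + i) (by omega)
    (V.mode_grading a p j u c hu hc) (huE j) d
  convert this using 2
  · push_cast; ring
  · push_cast; ring

variable {g : VOAAut V} {T : ℕ}

theorem mem_eigSpace {r : ℕ} {v : V.carrier} : v ∈ eigSpace V g T r ↔ g.lin v =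
    Complex.exp (-(2 * (Real.pi : ℂ) * Complex.I * (r : ℂ)) / (T : ℂ)) • v := Iff.rfl

theorem mem_eigSpace_zero {v : V.carrier} : v ∈ eigSpace V g T 0 ↔ g.lin v = v := by
  simp [mem_eigSpace]

theorem conformal_mem_eigSpace : V.conformal ∈ eigSpace V g T 0 :=
  mem_eigSpace_zero.2 g.map_conformal

theorem mode_mem_eigSpace {r : ℕ} {u v : V.carrier} (hu : u ∈ eigSpace V g T 0)
    (hv : v ∈ eigSpace V g T r) (m : ℤ) : V.mode u m v ∈ eigSpace V g T r := by
  rw [mem_eigSpace] at *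
  rw [g.map_mode, mem_eigSpace_zero.1 hu, hv, map_smul]

theorem D_mem_eigSpace {r : ℕ} {v : V.carrier} (hv : v ∈ eigSpace V g T r) :
    V.D v ∈ eigSpace V g T r :=
  Submodule.add_mem _ (mode_mem_eigSpace conformal_mem_eigSpace hv 0)
    (mode_mem_eigSpace conformal_mem_eigSpace hv 1)

theorem fres_mem {W : Type} [AddCommGroup W] [Module ℂ W] (S : Submodule ℂ W) {f : ℤ → W}
    (hf : ∀ m, f m ∈ S) (α : ℚ) (β : ℤ) : fres f α β ∈ S := by
  rw [fres]
  exact finsum_induction (fun x => x ∈ S) S.zero_mem (fun _ _ => S.add_mem)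
    fun j => S.smul_mem _ (hf _)

theorem res_mem_eigSpace {r : ℕ} {u v : V.carrier} (hu : u ∈ eigSpace V g T 0)
    (hv : v ∈ eigSpace V g T r) (α : ℚ) (β : ℤ) : V.res α β u v ∈ eigSpace V g T r :=
  fres_mem _ (fun m => mode_mem_eigSpace hu hv m) α β

theorem VOAAut.map_res (g : VOAAut V) (α : ℚ) (β : ℤ) (u v : V.carrier) :
    g.lin (V.res α β u v) = V.res α β (g.lin u) (g.lin v) := by
  have := V.map_res (g.lin : V.carrier →ₗ[ℂ] V.carrier) α β u v
  simpa [g.map_mode, ← V.res_eq_fres] using this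

theorem VOAAut.pow_succ_apply (g : VOAAut V) (t : ℕ) (v : V.carrier) :
    (g.lin ^ (t + 1)) v = g.lin ((g.lin ^ t) v) := by
  rw [pow_succ', LinearEquiv.mul_apply]

theorem VOAAut.map_D (g : VOAAut V) (v : V.carrier) : g.lin (V.D v) = V.D (g.lin v) := by
  rw [V.D_apply, V.D_apply, map_add, g.map_mode, g.map_mode, g.map_conformal]

theorem VOAAut.pow_map_D (g : VOAAut V) (t : ℕ) (v : V.carrier) :
    (g.lin ^ t) (V.D v) = V.D ((g.lin ^ t) v) := by
  induction t with
  | zero => simp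
  | succ t ih => rw [g.pow_succ_apply, ih, g.map_D, g.pow_succ_apply]

theorem VOAAut.pow_map_res (g : VOAAut V) (t : ℕ) {r : ℕ} {c : V.carrier}
    (hc : c ∈ eigSpace V g T r) (α : ℚ) (β : ℤ) (v : V.carrier) :
    (g.lin ^ t) (V.res α β c v) =
      Complex.exp (-(2 * (Real.pi : ℂ) * Complex.I * (r : ℂ)) / (T : ℂ)) ^ t •
        V.res α β c ((g.lin ^ t) v) := by
  induction t with
  | zero => simp
  | succ t ih =>
    rw [g.pow_succ_apply, ih, map_smul, g.map_res, mem_eigSpace.1 hc, V.res_smul_left,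
      g.pow_succ_apply, smul_smul, pow_succ]

/-- `eigProj` as a linear map. -/
def eigProjL (g : VOAAut V) (T r : ℕ) : V.carrier →ₗ[ℂ] V.carrier :=
  (T : ℂ)⁻¹ • ∑ t ∈ Finset.range T,
    Complex.exp ((2 * (Real.pi : ℂ) * Complex.I * (r : ℂ) * (t : ℂ)) / (T : ℂ)) •
      ((g.lin ^ t : V.carrier ≃ₗ[ℂ] V.carrier) : V.carrier →ₗ[ℂ] V.carrier)

theorem eigProjL_apply (r : ℕ) (v : V.carrier) : eigProjL g T r v = eigProj V g T r v := by
  simp [eigProjL, eigProj]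

theorem eigProj_mem_eigSpace (hT : 0 < T) (hg : g.lin ^ T = 1) (r : ℕ) (v : V.carrier) :
    eigProj V g T r v ∈ eigSpace V g T r := by
  have hT0 : (T : ℂ) ≠ 0 := by exact_mod_cast hT.ne'
  rw [mem_eigSpace, eigProj, map_smul, map_sum, smul_comm _ ((T : ℂ)⁻¹)]
  congr 1
  rw [Finset.smul_sum]
  set f : ℕ → V.carrier := fun t =>
    Complex.exp ((2 * (Real.pi : ℂ) * Complex.I * (r : ℂ) * (t : ℂ) - 2 * (Real.pi : ℂ) *
      Complex.I * (r : ℂ)) / (T : ℂ)) • ((g.lin ^ t) v) with hf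
  have h1 : ∀ t : ℕ, g.lin (Complex.exp ((2 * (Real.pi : ℂ) * Complex.I * (r : ℂ) * (t : ℂ)) / (T : ℂ)) •
      ((g.lin ^ t) v)) = f (t + 1) := by
    intro t
    rw [map_smul, ← g.pow_succ_apply, hf]
    simp only
    congr 2
    push_cast; ring
  have h2 : ∀ t : ℕ, Complex.exp (-(2 * (Real.pi : ℂ) * Complex.I * (r : ℂ)) / (T : ℂ)) •
      Complex.exp ((2 * (Real.pi : ℂ) * Complex.I * (r : ℂ) * (t : ℂ)) / (T : ℂ)) •
        ((g.lin ^ t) v) = f t := by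
    intro t
    rw [smul_smul, ← Complex.exp_add, hf]
    simp only
    congr 2
    ring
  have h3 : f T = f 0 := by
    simp only [hf, hg, pow_zero]
    congr 1
    rw [Complex.exp_eq_exp_iff_exists_int]
    refine ⟨r, ?_⟩
    push_cast
    field_simp
    ring
  simp only [h1, h2]
  have := Finset.sum_range_succ' f T
  rw [Finset.sum_range_succ, h3] at this
  exact (add_right_cancel this).symm

theorem eigProj_zero_of_mem (hT : 0 < T) {v : V.carrier} (hv : v ∈ eigSpace V g T 0) :
    eigProj V g T 0 v = v := by
  have hT0 : (T : ℂ) ≠ 0 := by exact_mod_cast hT.ne'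
  have h : ∀ t : ℕ, (g.lin ^ t) v = v := by
    intro t
    induction t with
    | zero => simp
    | succ t ih => rw [g.pow_succ_apply, ih, mem_eigSpace_zero.1 hv]
  simp only [eigProj, h]
  simp [← Nat.cast_smul_eq_nsmul ℂ, smul_smul, hT0]

theorem eigProj_zero_D (v : V.carrier) : eigProj V g T 0 (V.D v) = V.D (eigProj V g T 0 v) := by
  simp [eigProj, g.pow_map_D]

theorem eigProj_zero_res (hT : 0 < T) {r : ℕ} (hr : r < T) {c : V.carrier}
    (hc : c ∈ eigSpace V g T r) (α : ℚ) (β : ℤ) (v : V.carrier) :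
    eigProj V g T 0 (V.res α β c v) = V.res α β c (eigProj V g T (T - r) v) := by
  have hT0 : (T : ℂ) ≠ 0 := by exact_mod_cast hT.ne'
  simp only [eigProj, ← V.resL_apply, map_smul, map_sum]
  simp only [V.resL_apply, g.pow_map_res _ hc, smul_smul, ← Complex.exp_nat_mul, ← Complex.exp_add]
  congr 1
  refine Finset.sum_congr rfl fun t _ => ?_
  congr 1
  rw [Complex.exp_eq_exp_iff_exists_int]
  refine ⟨-t, ?_⟩
  rw [Nat.cast_sub hr.le]
  push_cast
  field_simp
  ring

theorem VOA.proj_of_mem {k : ℤ} {u : V.carrier} (hu : u ∈ V.wtSpace k) : V.proj k u = u :=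
  DirectSum.decompose_of_mem_same _ hu

theorem VOA.proj_of_mem_ne {k j : ℤ} {u : V.carrier} (hu : u ∈ V.wtSpace j) (h : j ≠ k) :
    V.proj k u = 0 :=
  DirectSum.decompose_of_mem_ne _ hu h

theorem VOA.proj_mem (k : ℤ) (u : V.carrier) : V.proj k u ∈ V.wtSpace k :=
  SetLike.coe_mem _

theorem VOA.proj_add (k : ℤ) (u v : V.carrier) : V.proj k (u + v) = V.proj k u + V.proj k v := by
  simp [VOA.proj, DirectSum.decompose_add]

theorem VOA.proj_smul (k : ℤ) (c : ℂ) (u : V.carrier) : V.proj k (c • u) = c • V.proj k u := by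
  rw [VOA.proj, DirectSum.decompose_smul]; rfl

theorem VOAAut.map_proj (g : VOAAut V) (k : ℤ) (u : V.carrier) :
    g.lin (V.proj k u) = V.proj k (g.lin u) := by
  classical
  induction u using DirectSum.Decomposition.inductionOn V.wtSpace with
  | zero => simp [VOA.proj]
  | @homogeneous j m =>
    by_cases h : j = k
    · subst h
      rw [VOA.proj_of_mem m.2, VOA.proj_of_mem ((g.map_wt _ _).1 m.2)]
    · rw [VOA.proj_of_mem_ne m.2 h, VOA.proj_of_mem_ne ((g.map_wt _ _).1 m.2) h, map_zero]
  | add x y hx hy => rw [V.proj_add, map_add, map_add, V.proj_add, hx, hy]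

theorem proj_mem_eigSpace {r : ℕ} {u : V.carrier} (hu : u ∈ eigSpace V g T r) (k : ℤ) :
    V.proj k u ∈ eigSpace V g T r := by
  rw [mem_eigSpace] at *
  rw [g.map_proj, hu, V.proj_smul]

open Classical in
theorem VOA.exists_sum_proj (u : V.carrier) : ∃ s : Finset ℤ, (∀ k ∉ s, V.proj k u = 0) ∧
    ∑ k ∈ s, V.proj k u = u :=
  ⟨(DirectSum.decompose V.wtSpace u).support, fun k hk => by
    simpa [VOA.proj] using DFinsupp.notMem_support_iff.1 hk, DirectSum.sum_support_decompose _ u⟩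

theorem eigSpace_le_of_homogeneous {r : ℕ} {S : Submodule ℂ V.carrier}
    (h : ∀ (k : ℤ) (u : V.carrier), u ∈ V.wtSpace k → u ∈ eigSpace V g T r → u ∈ S) :
    eigSpace V g T r ≤ S := by
  intro u hu
  obtain ⟨s, -, hs⟩ := V.exists_sum_proj u
  rw [← hs]
  exact Submodule.sum_mem _ fun k _ => h k _ (VOA.proj_mem k u) (proj_mem_eigSpace hu k)

end Eigenspaces

section LatticeRecursion

theorem bc_two (α : ℚ) : bc α 2 = α * (α - 1) / 2 := by
  have := bc_succ α 1
  rw [bc_one] at this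
  push_cast at this
  linear_combination this / 2

theorem bc_three (α : ℚ) : bc α 3 = α * (α - 1) * (α - 2) / 6 := by
  have := bc_succ α 2
  rw [bc_two] at this
  push_cast at this
  linear_combination this / 3

section Recursion

variable {Q : Type} [AddCommGroup Q] [Module ℂ Q]

theorem eq_bc_smul_of_pascal {F : ℕ → ℕ → Q} (hF : ∀ m k, F (m + 1) (k + 1) = F m (k + 1) + F m k)
    (h00 : F 0 0 = 0) {R : ℚ} (h0 : ∀ k, F 0 (k + 1) = bc (R - 1) k • F 0 1) (m k : ℕ)
    (hmk : m ≤ k + 1) : F m (k + 1) = bc (R - 1 + m) k • F 0 1 := by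
  induction m generalizing k with
  | zero => simpa using h0 k
  | succ m ih =>
    rw [hF, ih k (by omega)]
    cases k with
    | zero =>
      obtain rfl : m = 0 := by omega
      simp [h00, bc_zero]
    | succ k =>
      rw [ih k (by omega), ← add_smul, ← bc_pascal]
      congr 2
      push_cast; ring

/-- The two families of relations determine a doubly indexed family up to scale. -/
theorem eq_bc_smul_of_recursions {F : ℕ → ℕ → Q}
    (hF : ∀ m k, F (m + 1) (k + 1) = F m (k + 1) + F m k)
    {R : ℚ} (hR0 : 0 < R) (hR1 : R < 1) {p : ℤ} {g₁ g₂ : Q}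
    (h₁ : ∀ m k : ℕ, 1 ≤ m → m < k + 1 → ((p : ℂ) * m - R - m) • F m (k + 1)
      + (((k : ℂ) + 1) * (1 - p)) • F (m + 1) (k + 2) + bc (R - 1 + m) k • g₁ = 0)
    (h₂ : ∀ m k : ℕ, m < k → ((p : ℂ) * (m + 1) - R - m) • F m (k + 1)
      + (((k : ℂ) + 1) * (1 - p)) • F (m + 1) (k + 2) + bc (R - 1 + m) k • g₂ = 0)
    (hg : p ≤ 0 → g₁ = 0 ∧ g₂ = 0) :
    (∀ k, F 0 (k + 1) = bc (R - 1) k • F 0 1) ∧ (p < 0 → F 0 1 = 0) := by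
  have hRc : (R : ℂ) ≠ 0 := by exact_mod_cast hR0.ne'
  have hRc1 : (R : ℂ) - 1 ≠ 0 := by
    have : R - 1 ≠ 0 := by linarith
    exact_mod_cast this
  have hpR : (p : ℂ) - R ≠ 0 := by
    intro h
    have h1 : (p : ℚ) = R := by
      have : ((p : ℚ) : ℂ) = R := by push_cast; linear_combination h
      exact_mod_cast this
    rw [← h1] at hR0 hR1
    have : 0 < p := by exact_mod_cast hR0
    have : p < 1 := by exact_mod_cast hR1
    omega
  have hpR' : 1 - (p : ℂ) - R ≠ 0 := by
    intro h
    have h1 : (((1 - p : ℤ)) : ℚ) = R := by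
      have : ((((1 - p : ℤ)) : ℚ) : ℂ) = R := by push_cast; linear_combination h
      exact_mod_cast this
    rw [← h1] at hR0 hR1
    have : 0 < 1 - p := by exact_mod_cast hR0
    have : 1 - p < 1 := by exact_mod_cast hR1
    omega
  by_cases hp : p = 0
  · subst hp
    obtain ⟨rfl, rfl⟩ := hg le_rfl
    refine ⟨fun k => ?_, fun h => absurd h (lt_irrefl _)⟩
    have e : ∀ k : ℕ, 1 ≤ k → ((k : ℂ) + 1) • F 0 (k + 2) = ((R : ℂ) - 1 - k) • F 0 (k + 1) := by
      intro k hk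
      have := h₂ 0 k (by omega)
      rw [hF] at this
      simp only [Nat.cast_zero, Int.cast_zero, smul_zero] at this
      linear_combination (norm := module) this
    have e2 : F 0 2 = ((R : ℂ) - 1) • F 0 1 := by
      have a1 := h₁ 1 1 le_rfl (by omega)
      have a2 := e 1 le_rfl
      rw [hF 1 2, hF 0 2, hF 0 1] at a1
      simp only [Nat.cast_one, Int.cast_zero, smul_zero] at a1 a2
      linear_combination (norm := module) a1 - a2
    induction k with
    | zero => simp [bc_zero]
    | succ k ih =>
      rcases Nat.eq_zero_or_pos k with rfl | hk
      · rw [e2, bc_one]; push_cast; rfl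
      · have hne : ((k : ℂ) + 1) ≠ 0 := Nat.cast_add_one_ne_zero k
        apply smul_right_injective Q hne
        simp only
        rw [e k hk, ih, smul_smul, smul_smul, bc_succ]
        push_cast; rfl
  · have hpc : (p : ℂ) ≠ 0 := by exact_mod_cast hp
    set κ : Q := (p : ℂ)⁻¹ • (g₁ - g₂) with hκ
    have hκ' : (p : ℂ) • κ = g₁ - g₂ := by rw [hκ, smul_smul, mul_inv_cancel₀ hpc, one_smul]
    have hg2 : g₂ = g₁ - (p : ℂ) • κ := by rw [hκ']; abel
    have e1 : ∀ m k : ℕ, 1 ≤ m → m < k → F m (k + 1) = bc (R - 1 + m) k • κ := by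
      intro m k hm hk
      apply smul_right_injective Q hpc
      simp only
      have a1 := h₁ m k hm (by omega)
      have a2 := h₂ m k hk
      rw [hg2] at a2
      linear_combination (norm := module) a2 - a1
    have f13 := e1 1 2 le_rfl (by omega)
    have f24 := e1 2 3 (by omega) (by omega)
    have hR1' : R - 1 + ((1 : ℕ) : ℚ) = R := by push_cast; ring
    rw [hR1', bc_two] at f13
    rw [bc_three] at f24
    have hg1 : g₁ = ((p : ℂ) * R) • κ := by
      have a := h₁ 1 2 le_rfl (by omega)
      rw [f13, f24, hR1', bc_two] at a
      have hne : ((R : ℂ) * (R - 1) / 2) ≠ 0 := by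
        simp [hRc, hRc1]
      apply smul_right_injective Q hne
      simp only
      push_cast at a
      linear_combination (norm := module) a
    rw [hg1] at hg2
    have f12 : F 1 2 = (R : ℂ) • κ := by
      have a := h₁ 1 1 le_rfl (by omega)
      rw [hF 1 2, f13, hg1, hR1', bc_one] at a
      apply smul_right_injective Q hpR'
      simp only
      push_cast at a
      linear_combination (norm := module) a
    have f02 : F 0 2 = ((R : ℂ) - 1) • κ := by
      have a := h₂ 0 1 (by omega)
      rw [f13, hg2, Nat.cast_zero, Nat.cast_zero, add_zero, bc_one] at a
      apply smul_right_injective Q hpR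
      simp only
      push_cast at a
      linear_combination (norm := module) a
    have f01 : F 0 1 = κ := by
      have a := hF 0 1
      rw [f12, f02] at a
      linear_combination (norm := module) -a
    refine ⟨fun k => ?_, fun h => ?_⟩
    · rw [f01]
      induction k with
      | zero => simp [bc_zero, f01]
      | succ k ih =>
        rcases Nat.eq_zero_or_pos k with rfl | hk
        · rw [f02, bc_one]; push_cast; rfl
        · have a := hF 0 (k + 1)
          have b := bc_pascal (R - 1) k
          rw [ih, e1 1 (k + 1) le_rfl (by omega), Nat.cast_one, b] at a
          linear_combination (norm := module) -a
    · have := (hg h.le).1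
      rw [hg1] at this
      rw [f01]
      simpa [hpc, hRc] using this

end Recursion

end LatticeRecursion

section ZeroPoleCase

variable {V : VOA}

/-- The situation in which the generators `u ∘ v` with `u` in a fixed eigenspace `E` involve no
negative power of `z`: here `E'` is the eigenspace dual to `E` and `E₀` the fixed-point space. -/
structure ZeroPole (V : VOA) (O E₀ E E' : Submodule ℂ V.carrier) (R : ℚ) : Prop where
  pos : 0 < R
  lt_one : R < 1
  left_mem : ∀ u ∈ E₀, ∀ c ∈ E, ∀ m, V.mode u m c ∈ E
  right_mem : ∀ u ∈ E₀, ∀ d ∈ E', ∀ m, V.mode u m d ∈ E'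
  conformal_mem : V.conformal ∈ E₀
  gen : ∀ (p : ℤ) (c d : V.carrier), c ∈ V.wtSpace p → c ∈ E → d ∈ E' →
    V.res (p - 1 + R) 0 c d ∈ O
  gen' : ∀ (p : ℤ) (c d : V.carrier), c ∈ V.wtSpace p → c ∈ E → d ∈ E' →
    V.res (p - 2 + R) 0 c d ∈ O
  fixed : ∀ (a : ℤ) (u v : V.carrier), u ∈ V.wtSpace a → u ∈ E₀ → ∀ m k : ℕ, 1 ≤ m → m ≤ k →
    V.res (a - 1 + m) (k + 1) u v ∈ O

/-- The class of `Res_z Y(c,z)d (1+z)^{p-1+R+m} z^{-k}` modulo `O`, as a function of `c`. -/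
def resClass (O : Submodule ℂ V.carrier) (R : ℚ) (d : V.carrier) (p : ℤ) (m k : ℕ) :
    V.carrier →ₗ[ℂ] V.carrier ⧸ O :=
  O.mkQ ∘ₗ (V.resL (p - 1 + R + m) k).flip d

theorem resClass_apply (O : Submodule ℂ V.carrier) (R : ℚ) (d : V.carrier) (p : ℤ) (m k : ℕ)
    (c : V.carrier) :
    resClass O R d p m k c = Submodule.Quotient.mk (V.res (p - 1 + R + m) k c d) := rfl

theorem resClass_pascal (O : Submodule ℂ V.carrier) (R : ℚ) (d : V.carrier) (p : ℤ) (m k : ℕ)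
    (c : V.carrier) : resClass O R d p (m + 1) (k + 1) c =
      resClass O R d p m (k + 1) c + resClass O R d p m k c := by
  simp only [resClass_apply]
  rw [← Submodule.Quotient.mk_add]
  have := V.res_pascal (p - 1 + R + m) (k + 1) c d
  rw [add_sub_cancel_right] at this
  rw [Nat.cast_succ k, ← this]
  congr 2
  push_cast; ring

theorem resClass_translation (O : Submodule ℂ V.carrier) (R : ℚ) (d : V.carrier) (p : ℤ) (m k : ℕ)
    (c : V.carrier) : resClass O R d (p + 1) m k (V.mode V.conformal 0 c) =
      (-((p : ℂ) + R + m)) • resClass O R d p m k c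
        + (k : ℂ) • resClass O R d p (m + 1) (k + 1) c := by
  simp only [resClass_apply]
  rw [← Submodule.Quotient.mk_smul, ← Submodule.Quotient.mk_smul, ← Submodule.Quotient.mk_add]
  have := V.res_translation (p - 1 + R + m) k c d
  rw [show (((p + 1 : ℤ)) : ℚ) - 1 + R + m = p - 1 + R + m + 1 by push_cast; ring, this,
    show (p : ℚ) - 1 + R + ((m + 1 : ℕ) : ℚ) = p - 1 + R + m + 1 by push_cast; ring]
  congr 3
  push_cast; ring

/-- All classes with `m ≤ k` are proportional to the one with `m = 0` and `k = 1`. -/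
def ResClassConst (O E : Submodule ℂ V.carrier) (R : ℚ) (d : V.carrier) (p : ℤ) : Prop :=
  ∀ c ∈ V.wtSpace p, c ∈ E →
    (∀ k, resClass O R d p 0 (k + 1) c = bc (R - 1) k • resClass O R d p 0 1 c) ∧
      (p < 0 → resClass O R d p 0 1 c = 0)

namespace ZeroPole

variable {O E₀ E E' : Submodule ℂ V.carrier} {R : ℚ}

theorem sum_resClass (h : ZeroPole V O E₀ E E' R) {a p : ℤ} {u c d : V.carrier}
    (huE : u ∈ E₀) (hc : c ∈ V.wtSpace p) (hcE : c ∈ E) (hd : d ∈ E')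
    {J : ℕ} (hJ : ∀ j : ℕ, J ≤ j → V.mode u j c = 0) (m k : ℕ) :
    Submodule.Quotient.mk (p := O) (V.res (a - 1 + m) k u (V.res (p - 1 + R) 0 c d)) =
      ∑ j ∈ Finset.range J, ∑ i ∈ Finset.range (j + 1), (bc (a - 1 + m) (j - i) * bc (-(k : ℚ)) i) •
        resClass O R d (a + p - j - 1) (m + i) (k + i) (V.mode u j c) := by
  have hd' : V.res (a - 1 + m) k u d ∈ E' := fres_mem _ (fun m => h.right_mem u huE d hd m) _ _
  have h1 := (Submodule.Quotient.mk_eq_zero O).2 (h.gen p c _ hc hcE hd')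
  rw [← sub_add_cancel (V.res (a - 1 + m) k u (V.res (p - 1 + R) 0 c d))
    (V.res (p - 1 + R) 0 c (V.res (a - 1 + m) k u d)), Submodule.Quotient.mk_add, h1, add_zero,
    V.res_commutator u c d hJ, ← Submodule.mkQ_apply, map_sum]
  refine Finset.sum_congr rfl fun j _ => ?_
  rw [map_sum]
  refine Finset.sum_congr rfl fun i _ => ?_
  rw [map_smul, resClass_apply, Submodule.mkQ_apply, Int.cast_natCast]
  congr 3
  · push_cast; ring

theorem relation₁ (h : ZeroPole V O E₀ E E' R) {a p : ℤ} {u c d : V.carrier}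
    (hu : u ∈ V.wtSpace a) (huE : u ∈ E₀) (hc : c ∈ V.wtSpace p) (hcE : c ∈ E) (hd : d ∈ E')
    {J : ℕ} (hJ : ∀ j : ℕ, J ≤ j → V.mode u j c = 0) {m k : ℕ} (hm : 1 ≤ m) (hmk : m ≤ k) :
    ∑ j ∈ Finset.range J, ∑ i ∈ Finset.range (j + 1),
      (bc (a - 1 + m) (j - i) * bc (-((k + 1 : ℕ) : ℚ)) i) •
        resClass O R d (a + p - j - 1) (m + i) (k + 1 + i) (V.mode u j c) = 0 := by
  rw [← h.sum_resClass huE hc hcE hd hJ, Submodule.Quotient.mk_eq_zero]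
  exact h.fixed a u _ hu huE m k hm hmk

theorem relation₂ (h : ZeroPole V O E₀ E E' R) {a p : ℤ} {u c d : V.carrier}
    (hu : u ∈ V.wtSpace a) (huE : u ∈ E₀) (hc : c ∈ V.wtSpace p) (hcE : c ∈ E) (hd : d ∈ E')
    {J : ℕ} (hJ : ∀ j : ℕ, J ≤ j → V.mode u j c = 0) {m k : ℕ} (hmk : m < k) :
    ∑ j ∈ Finset.range J, ∑ i ∈ Finset.range (j + 1),
      (bc (a + m) (j - i) * bc (-((k + 1 : ℕ) : ℚ)) i) •
        resClass O R d (a + p - j - 1) (m + i) (k + 1 + i) (V.mode u j c) = 0 := by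
  have hd' : V.res (a + m) (k + 1 : ℕ) u d ∈ E' :=
    fres_mem _ (fun m => h.right_mem u huE d hd m) _ _
  have h1 := h.gen' p c _ hc hcE hd'
  have h2 := h.fixed a u (V.res (p - 2 + R) 0 c d) hu huE (m + 1) k (by omega) (by omega)
  rw [show (a : ℚ) - 1 + ((m + 1 : ℕ) : ℚ) = a + m by push_cast; ring] at h2
  have h3 := (Submodule.Quotient.mk_eq_zero O).2 (O.sub_mem h2 h1)
  push_cast at h3
  rw [V.res_commutator u c d hJ, ← Submodule.mkQ_apply, map_sum] at h3
  rw [← h3]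
  refine Finset.sum_congr rfl fun j _ => ?_
  rw [map_sum]
  refine Finset.sum_congr rfl fun i _ => ?_
  rw [map_smul, resClass_apply, Submodule.mkQ_apply]
  congr 3
  · push_cast; ring

theorem resClass_zero_zero (h : ZeroPole V O E₀ E E' R) {p : ℤ} {c d : V.carrier}
    (hc : c ∈ V.wtSpace p) (hcE : c ∈ E) (hd : d ∈ E') : resClass O R d p 0 0 c = 0 := by
  rw [resClass_apply, Submodule.Quotient.mk_eq_zero]
  simpa using h.gen p c d hc hcE hd

theorem resClass_eq (h : ZeroPole V O E₀ E E' R) {p : ℤ} {c d : V.carrier} (hd : d ∈ E')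
    (hp : ResClassConst O E R d p) (hc : c ∈ V.wtSpace p) (hcE : c ∈ E) {m k : ℕ}
    (hmk : m ≤ k + 1) :
    resClass O R d p m (k + 1) c = bc (R - 1 + m) k • resClass O R d p 0 1 c :=
  eq_bc_smul_of_pascal (F := fun m k => resClass O R d p m k c)
    (fun m k => resClass_pascal O R d p m k c) (h.resClass_zero_zero hc hcE hd)
    (hp c hc hcE).1 m k hmk

theorem sum_resClass_eq (h : ZeroPole V O E₀ E E' R) {p : ℤ} {c d : V.carrier} (hd : d ∈ E')
    (hp : ResClassConst O E R d p) (hc : c ∈ V.wtSpace p) (hcE : c ∈ E) {m k : ℕ}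
    (hmk : m ≤ k + 1) (A : ℚ) (j : ℕ) :
    ∑ i ∈ Finset.range (j + 1), (bc A (j - i) * bc (-((k + 1 : ℕ) : ℚ)) i) •
        resClass O R d p (m + i) (k + 1 + i) c
      = bc (R - 1 + m) k • bc (A - R - m) j • resClass O R d p 0 1 c := by
  rw [smul_smul, mul_comm, show A - R - m = A - (R - 1 + m) - 1 by ring, ← sum_bc_mul_bc,
    Finset.sum_smul]
  refine Finset.sum_congr rfl fun i _ => ?_
  rw [show k + 1 + i = k + i + 1 by ring, h.resClass_eq hd hp hc hcE (by omega), smul_smul]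
  congr 3
  push_cast; ring

theorem resClassConst (h : ZeroPole V O E₀ E E' R) {d : V.carrier} (hd : d ∈ E') (p : ℤ) :
    ResClassConst O E R d p := by
  obtain ⟨N, hN⟩ := V.bounded_below
  suffices H : ∀ (n : ℕ) (p : ℤ), p < N + n → ResClassConst O E R d p from
    H (p - N + 1).toNat p (by omega)
  intro n
  induction n with
  | zero =>
    intro p hp c hc _
    have := hN p (by simpa using hp)
    rw [this, Submodule.mem_bot] at hc
    simp [hc]
  | succ n ih =>
    intro p hp c hc hcE
    obtain ⟨J, hJ⟩ := V.exists_nat_trunc V.conformal c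
    have hJ2 : ∀ j : ℕ, J + 2 ≤ j → V.mode V.conformal j c = 0 := fun j hj => hJ j (by omega)
    have hcj : ∀ j : ℕ, V.mode V.conformal j c ∈ V.wtSpace (2 + p - j - 1) := fun j =>
      V.mode_grading 2 p j _ _ V.conformal_wt hc
    have hcjE : ∀ j : ℕ, V.mode V.conformal j c ∈ E := fun j =>
      h.left_mem _ h.conformal_mem c hcE j
    have hlow : ∀ j : ℕ, ResClassConst O E R d (2 + p - ((j + 1 + 1 : ℕ) : ℤ) - 1) := fun j =>
      ih _ (by push_cast at hp ⊢; omega)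
    have e0 : ∀ (A : ℚ) (m k : ℕ), ∑ i ∈ Finset.range (0 + 1),
        (bc A (0 - i) * bc (-((k + 1 : ℕ) : ℚ)) i) •
        resClass O R d (2 + p - ((0 : ℕ) : ℤ) - 1) (m + i) (k + 1 + i)
          (V.mode V.conformal ((0 : ℕ) : ℤ) c)
        = (-((p : ℂ) + R + m)) • resClass O R d p m (k + 1) c
          + ((k : ℂ) + 1) • resClass O R d p (m + 1) (k + 2) c := by
      intro A m k
      rw [zero_add, Finset.sum_range_one, show 2 + p - ((0 : ℕ) : ℤ) - 1 = p + 1 by push_cast; ring,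
        bc_zero, bc_zero, mul_one, one_smul, add_zero, add_zero, Nat.cast_zero,
        resClass_translation]
      push_cast; rfl
    have e1 : ∀ (A : ℚ) (m k : ℕ), ∑ i ∈ Finset.range (0 + 1 + 1),
        (bc A (0 + 1 - i) * bc (-((k + 1 : ℕ) : ℚ)) i) •
        resClass O R d (2 + p - ((0 + 1 : ℕ) : ℤ) - 1) (m + i) (k + 1 + i)
          (V.mode V.conformal ((0 + 1 : ℕ) : ℤ) c)
        = ((p : ℂ) * A) • resClass O R d p m (k + 1) c
          - (p * ((k : ℂ) + 1)) • resClass O R d p (m + 1) (k + 2) c := by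
      intro A m k
      rw [zero_add, Finset.sum_range_succ, Finset.sum_range_one,
        show 2 + p - ((1 : ℕ) : ℤ) - 1 = p by push_cast; ring, Nat.cast_one, V.L0_grading p c hc,
        map_smul, map_smul, Nat.sub_zero, Nat.sub_self, bc_zero, bc_zero, bc_one, bc_one,
        add_zero, add_zero]
      push_cast
      module
    have hrec := eq_bc_smul_of_recursions (F := fun m k => resClass O R d p m k c)
      (fun m k => resClass_pascal O R d p m k c) h.pos h.lt_one (p := p)
      (g₁ := ∑ j ∈ Finset.range J, bc (1 - R) (j + 1 + 1) •
        resClass O R d (2 + p - ((j + 1 + 1 : ℕ) : ℤ) - 1) 0 1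
          (V.mode V.conformal ((j + 1 + 1 : ℕ) : ℤ) c))
      (g₂ := ∑ j ∈ Finset.range J, bc (2 - R) (j + 1 + 1) •
        resClass O R d (2 + p - ((j + 1 + 1 : ℕ) : ℤ) - 1) 0 1
          (V.mode V.conformal ((j + 1 + 1 : ℕ) : ℤ) c)) ?_ ?_ ?_
    · exact hrec
    · intro m k hm hk
      have a := h.relation₁ V.conformal_wt h.conformal_mem hc hcE hd hJ2 hm (Nat.lt_succ_iff.1 hk)
      rw [Finset.sum_range_succ', Finset.sum_range_succ', e0, e1] at a
      rw [Finset.sum_congr rfl fun j _ => h.sum_resClass_eq hd (hlow j) (hcj _) (hcjE _)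
        (by omega : m ≤ k + 1) _ _, ← Finset.smul_sum] at a
      rw [show (((2 : ℤ)) : ℚ) - 1 + m - R - m = 1 - R by push_cast; ring] at a
      rw [← a]
      push_cast
      module
    · intro m k hk
      have a := h.relation₂ V.conformal_wt h.conformal_mem hc hcE hd hJ2 hk
      rw [Finset.sum_range_succ', Finset.sum_range_succ', e0, e1] at a
      rw [Finset.sum_congr rfl fun j _ => h.sum_resClass_eq hd (hlow j) (hcj _) (hcjE _)
        (by omega : m ≤ k + 1) _ _, ← Finset.smul_sum] at a
      rw [show (((2 : ℤ)) : ℚ) + m - R - m = 2 - R by push_cast; ring] at a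
      rw [← a]
      push_cast
      module
    · intro hp0
      constructor <;> refine Finset.sum_eq_zero fun j _ => ?_
      · rw [((hlow j) _ (hcj _) (hcjE _)).2 (by push_cast; omega), smul_zero]
      · rw [((hlow j) _ (hcj _) (hcjE _)).2 (by push_cast; omega), smul_zero]

theorem res_res_mem (h : ZeroPole V O E₀ E E' R) {a p : ℤ} {u c d : V.carrier}
    (hu : u ∈ V.wtSpace a) (huE : u ∈ E₀) (hc : c ∈ V.wtSpace p) (hcE : c ∈ E) (hd : d ∈ E')
    {m k : ℕ} (hmk : m ≤ k) : V.res (a - 1 + m) k u (V.res (p - 1 + R) 0 c d) ∈ O := by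
  obtain ⟨J, hJ⟩ := V.exists_nat_trunc u c
  have hcj : ∀ j : ℕ, V.mode u j c ∈ V.wtSpace (a + p - j - 1) := fun j =>
    V.mode_grading a p j _ _ hu hc
  have hcjE : ∀ j : ℕ, V.mode u j c ∈ E := fun j => h.left_mem _ huE c hcE j
  rw [← Submodule.Quotient.mk_eq_zero, h.sum_resClass huE hc hcE hd hJ]
  cases k with
  | zero =>
    obtain rfl : m = 0 := by omega
    refine Finset.sum_eq_zero fun j _ => Finset.sum_eq_zero fun i _ => ?_
    cases i with
    | zero => rw [h.resClass_zero_zero (hcj j) (hcjE j) hd, smul_zero]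
    | succ i => rw [Nat.cast_zero, neg_zero, bc_zero_succ, mul_zero, zero_smul]
  | succ k =>
    have hS : ∀ m k : ℕ, m ≤ k + 1 → ∑ j ∈ Finset.range J, ∑ i ∈ Finset.range (j + 1),
        (bc (a - 1 + m) (j - i) * bc (-((k + 1 : ℕ) : ℚ)) i) •
          resClass O R d (a + p - j - 1) (m + i) (k + 1 + i) (V.mode u j c)
        = bc (R - 1 + m) k • ∑ j ∈ Finset.range J, bc (a - 1 - R) j •
          resClass O R d (a + p - j - 1) 0 1 (V.mode u j c) := by
      intro m k hmk
      rw [Finset.sum_congr rfl fun j _ => h.sum_resClass_eq hd (h.resClassConst hd _) (hcj j)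
        (hcjE j) hmk _ _, ← Finset.smul_sum, show (a : ℚ) - 1 + m - R - m = a - 1 - R by ring]
    have h1 := h.relation₁ hu huE hc hcE hd hJ (m := 1) (k := 1) le_rfl le_rfl
    have hR : (R : ℂ) ≠ 0 := by exact_mod_cast h.pos.ne'
    rw [hS 1 1 (by omega), Nat.cast_one, sub_add_cancel, bc_one, smul_eq_zero_iff_right hR] at h1
    rw [hS m k hmk, h1, smul_zero]

end ZeroPole

end ZeroPoleCase

section Generators

variable {V : VOA} {g : VOAAut V} {T l i : ℕ}

theorem deltaI_zero : deltaI T i 0 = 1 := by simp [deltaI]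

theorem deltaI_self : deltaI T i T = 1 := by simp [deltaI]

theorem range_D_le_Ogn : LinearMap.range V.D ≤ Ogn V g T l i := by
  rintro _ ⟨u, rfl⟩
  exact Submodule.subset_span (Or.inl ⟨u, rfl⟩)

theorem res_mem_Ogn {r : ℕ} (hr : r < T) {k : ℤ} {u : V.carrier} (hu : u ∈ V.wtSpace k)
    (hur : u ∈ eigSpace V g T r) (v : V.carrier) :
    V.res ((k : ℚ) - 1 + (deltaI T i r : ℚ) + (l : ℚ) + (r : ℚ) / (T : ℚ))
      (2 * (l : ℤ) + (deltaI T i r : ℤ) + (deltaI T i (T - r) : ℤ)) u v ∈ Ogn V g T l i :=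
  Submodule.subset_span (Or.inr ⟨r, hr, k, u, v, hu, hur, rfl⟩)

theorem res_fixed_mem_Ogn (hT : 0 < T) {k : ℤ} {u : V.carrier} (hu : u ∈ V.wtSpace k)
    (hu0 : u ∈ eigSpace V g T 0) (v : V.carrier) :
    V.res (k + l) (2 * (l : ℤ) + 2) u v ∈ Ogn V g T l i := by
  have := res_mem_Ogn (l := l) (i := i) hT hu hu0 v
  rw [deltaI_zero, tsub_zero, deltaI_self] at this
  convert this using 2
  · push_cast; ring
  · push_cast; ring

theorem zeroPole_Ogn {r : ℕ} (hr : r < T) (h₁ : deltaI T i r = 0) (h₂ : deltaI T i (T - r) = 0) :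
    ZeroPole V (Ogn V g T 0 i) (eigSpace V g T 0) (eigSpace V g T r) (eigSpace V g T (T - r))
      ((r : ℚ) / T) := by
  have hr0 : 0 < r := by
    rcases Nat.eq_zero_or_pos r with rfl | h
    · simp [deltaI_zero] at h₁
    · exact h
  have hT0 : (T : ℚ) ≠ 0 := by exact_mod_cast (hr0.trans hr).ne'
  have hT : 0 < (T : ℚ) := by exact_mod_cast hr0.trans hr
  refine ⟨by positivity, (div_lt_one hT).2 (by exact_mod_cast hr),
    fun u hu c hc m => mode_mem_eigSpace hu hc m, fun u hu c hc m => mode_mem_eigSpace hu hc m,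
    conformal_mem_eigSpace, fun p c d hc hcr _ => ?_, fun p c d hc hcr hd => ?_,
    fun a u v hu hu0 m k hm hmk => ?_⟩
  · simpa [h₁, h₂] using res_mem_Ogn (l := 0) (i := i) hr hc hcr d
  · have key : eigSpace V g T (T - r) ≤
        (Ogn V g T 0 i).comap (V.resL (p - 2 + (r : ℚ) / T) 0 c) := by
      refine eigSpace_le_of_homogeneous fun b d hd hdr => ?_
      rw [Submodule.mem_comap, VOA.resL_apply]
      have hs := range_D_le_Ogn (g := g) (T := T) (l := 0) (i := i)
        (VOA.res_skew hd hc (p - 2 + (r : ℚ) / T) 0)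
      have hgen := res_mem_Ogn (l := 0) (i := i) (by omega) hd hdr c
      rw [Nat.sub_sub_self hr.le, h₁, h₂, Nat.cast_sub hr.le, sub_div, div_self hT0] at hgen
      refine ((Ogn V g T 0 i).sub_mem_iff_left (Submodule.smul_mem _ _ ?_)).1 hs
      convert hgen using 2
      · push_cast; ring
      · simp
    exact key hd
  · obtain ⟨m, rfl⟩ := Nat.exists_eq_add_of_le' hm
    obtain ⟨k, rfl⟩ := Nat.exists_eq_add_of_le' (hm.trans hmk)
    have := VOA.res_mem_of_generators (O := Ogn V g T 0 i) (E := eigSpace V g T 0) (σ := 0) (b := 2)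
      (fun u hu => mode_mem_eigSpace conformal_mem_eigSpace hu 0) (by norm_num)
      (fun k u v hu hu0 => by
        simpa using res_fixed_mem_Ogn (l := 0) (i := i) (by omega) hu hu0 v)
      k (s := m) (by omega) hu hu0 v
    convert this using 2
    · push_cast; ring
    · push_cast; ring

theorem res_generator_mem_Ogn {r : ℕ} (hr : r < T) {a p : ℤ} {u c d : V.carrier}
    (hu : u ∈ V.wtSpace a) (hu0 : u ∈ eigSpace V g T 0) (hc : c ∈ V.wtSpace p)
    (hcr : c ∈ eigSpace V g T r) (hd : d ∈ eigSpace V g T (T - r)) {s k : ℕ} (hs : s ≤ k) :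
    V.res (a - 1 + s) k u
      (V.res ((p : ℚ) - 1 + (deltaI T i r : ℚ) + (l : ℚ) + (r : ℚ) / (T : ℚ))
        (2 * (l : ℤ) + (deltaI T i r : ℤ) + (deltaI T i (T - r) : ℤ)) c d) ∈ Ogn V g T l i := by
  rcases Nat.eq_zero_or_pos (2 * l + deltaI T i r + deltaI T i (T - r)) with h | h
  · obtain ⟨rfl, h₁, h₂⟩ : l = 0 ∧ deltaI T i r = 0 ∧ deltaI T i (T - r) = 0 := by omega
    simpa [h₁, h₂] using (zeroPole_Ogn hr h₁ h₂).res_res_mem hu hu0 hc hcr hd hs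
  · have := VOA.res_res_mem_of_generators (O := Ogn V g T l i) (E := eigSpace V g T r)
      (σ := -1 + deltaI T i r + l + (r : ℚ) / T)
      (b := 2 * (l : ℤ) + deltaI T i r + deltaI T i (T - r))
      (fun u hu => mode_mem_eigSpace conformal_mem_eigSpace hu 0) (by exact_mod_cast h)
      (fun k u v hu hur => by
        convert res_mem_Ogn (l := l) (i := i) hr hu hur v using 2
        ring)
      hu (fun m => mode_mem_eigSpace hu0 hcr m) hc hcr d hs
    convert this using 3
    ring

theorem OgnV0_le (hT : 0 < T) : OgnV0 V g T l ≤ Ogn V g T l i ⊓ eigSpace V g T 0 := by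
  refine Submodule.span_le.2 ?_
  rintro x (⟨u, hu, rfl⟩ | ⟨k, u, v, hu, hu0, hv0, rfl⟩)
  · exact ⟨range_D_le_Ogn ⟨u, rfl⟩, D_mem_eigSpace hu⟩
  · exact ⟨res_fixed_mem_Ogn hT hu hu0 v, res_mem_eigSpace hu0 hv0 _ _⟩

end Generators

section Products

variable {V : VOA} {g : VOAAut V} {T l i : ℕ}

theorem choose_mul_succ (m l : ℕ) : ((l : ℂ) + m + 1) * ((m + l).choose l : ℂ) =
    ((m : ℂ) + 1) * ((m + 1 + l).choose l : ℂ) := by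
  have h := Nat.add_one_mul_choose_eq (m + l) m
  rw [Nat.choose_symm_add, show (m + l + 1).choose (m + 1) = (m + 1 + l).choose l by
    rw [show m + l + 1 = m + 1 + l by ring, Nat.choose_symm_add]] at h
  have := congrArg (Nat.cast : ℕ → ℂ) h
  push_cast at this
  linear_combination this

/-- `starFor` as a bilinear map, for a fixed weight. -/
def starForL (V : VOA) (l : ℕ) (k : ℤ) : V.carrier →ₗ[ℂ] V.carrier →ₗ[ℂ] V.carrier :=
  ∑ m ∈ Finset.range (l + 1), ((-1 : ℂ) ^ m * (Nat.choose (m + l) l : ℂ)) •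
    V.resL ((k : ℚ) + (l : ℚ)) ((l : ℤ) + (m : ℤ) + 1)

theorem starForL_apply (k : ℤ) (u v : V.carrier) : starForL V l k u v = starFor V l k u v := by
  simp [starForL, starFor]

/-- Up to sign and modulo the range of `L(-1) + L(0)`, the product `x *_l u` for `u` homogeneous
of weight `k`, as obtained from skew symmetry. -/
def starRevL (V : VOA) (l : ℕ) (k : ℤ) : V.carrier →ₗ[ℂ] V.carrier →ₗ[ℂ] V.carrier :=
  ∑ m ∈ Finset.range (l + 1), (Nat.choose (m + l) l : ℂ) •
    V.resL ((k : ℚ) - 1 + (m : ℚ)) ((l : ℤ) + (m : ℤ) + 1)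

theorem starRevL_apply (k : ℤ) (u v : V.carrier) : starRevL V l k u v =
    ∑ m ∈ Finset.range (l + 1), (Nat.choose (m + l) l : ℂ) •
      V.res ((k : ℚ) - 1 + (m : ℚ)) ((l : ℤ) + (m : ℤ) + 1) u v := by
  simp [starRevL]

theorem starFor_D_mem_Ogn (hT : 0 < T) {a : ℤ} {u : V.carrier} (hu : u ∈ V.wtSpace a)
    (hu0 : u ∈ eigSpace V g T 0) (w : V.carrier) : starFor V l a u (V.D w) ∈ Ogn V g T l i := by
  set f : ℕ → V.carrier := fun m => ((-1 : ℂ) ^ m * m * ((m + l).choose l : ℂ)) •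
    V.res ((a : ℚ) + l) ((l : ℤ) + m + 1) u w with hf
  have hterm : ∀ m : ℕ, ((-1 : ℂ) ^ m * (Nat.choose (m + l) l : ℂ)) •
      V.res ((a : ℚ) + (l : ℚ)) ((l : ℤ) + (m : ℤ) + 1) u (V.D w) =
      ((-1 : ℂ) ^ m * (Nat.choose (m + l) l : ℂ)) •
        V.D (V.res ((a : ℚ) + (l : ℚ)) ((l : ℤ) + (m : ℤ) + 1) u w) + (f (m + 1) - f m) := by
    intro m
    have hp := V.res_pascal ((a : ℚ) + l) ((l : ℤ) + m + 1 + 1) u w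
    rw [add_sub_cancel_right] at hp
    rw [VOA.res_D hu, hp]
    simp only [hf]
    rw [show (l : ℤ) + ((m + 1 : ℕ) : ℤ) + 1 = (l : ℤ) + m + 1 + 1 by push_cast; ring]
    push_cast
    rw [show (-1 : ℂ) ^ (m + 1) * (m + 1) * ((m + 1 + l).choose l : ℂ) =
      -((-1 : ℂ) ^ m * (((l : ℂ) + m + 1) * ((m + l).choose l : ℂ))) by
        rw [choose_mul_succ]; ring]
    module
  rw [starFor, Finset.sum_congr rfl fun m _ => hterm m, Finset.sum_add_distrib,
    Finset.sum_range_sub]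
  refine Submodule.add_mem _ (Submodule.sum_mem _ fun m _ => Submodule.smul_mem _ _
    (range_D_le_Ogn ⟨_, rfl⟩)) (Submodule.sub_mem _ (Submodule.smul_mem _ _ ?_) (by simp [hf]))
  have := res_fixed_mem_Ogn (l := l) (i := i) hT hu hu0 w
  convert this using 2
  push_cast; ring

theorem starRevL_D_mem_Ogn (hT : 0 < T) {a : ℤ} {u : V.carrier} (hu : u ∈ V.wtSpace a)
    (hu0 : u ∈ eigSpace V g T 0) (w : V.carrier) :
    starRevL V l a u (V.D w) ∈ Ogn V g T l i := by
  set f : ℕ → V.carrier := fun m => ((m : ℂ) * ((m + l).choose l : ℂ)) •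
    V.res ((a : ℚ) - 1 + m) ((l : ℤ) + m + 1) u w with hf
  have hterm : ∀ m : ℕ, (Nat.choose (m + l) l : ℂ) •
      V.res ((a : ℚ) - 1 + (m : ℚ)) ((l : ℤ) + (m : ℤ) + 1) u (V.D w) =
      (Nat.choose (m + l) l : ℂ) •
        V.D (V.res ((a : ℚ) - 1 + (m : ℚ)) ((l : ℤ) + (m : ℤ) + 1) u w) + (f m - f (m + 1)) := by
    intro m
    rw [VOA.res_D hu]
    simp only [hf]
    rw [show (l : ℤ) + ((m + 1 : ℕ) : ℤ) + 1 = (l : ℤ) + m + 1 + 1 by push_cast; ring,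
      show (a : ℚ) - 1 + ((m + 1 : ℕ) : ℚ) = (a : ℚ) - 1 + m + 1 by push_cast; ring]
    push_cast
    rw [← choose_mul_succ]
    module
  rw [starRevL_apply, Finset.sum_congr rfl fun m _ => hterm m, Finset.sum_add_distrib,
    Finset.sum_range_sub']
  refine Submodule.add_mem _ (Submodule.sum_mem _ fun m _ => Submodule.smul_mem _ _
    (range_D_le_Ogn ⟨_, rfl⟩)) (Submodule.sub_mem _ (by simp [hf]) (Submodule.smul_mem _ _ ?_))
  have := res_fixed_mem_Ogn (l := l) (i := i) hT hu hu0 w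
  convert this using 2
  · push_cast; ring
  · push_cast; ring

theorem starFor_sub_starRevL_mem {a b : ℤ} {u v : V.carrier} (hu : u ∈ V.wtSpace a)
    (hv : v ∈ V.wtSpace b) :
    starFor V l b v u - (-1 : ℂ) ^ l • starRevL V l a u v ∈ LinearMap.range V.D := by
  rw [starFor, starRevL_apply, Finset.smul_sum, ← Finset.sum_sub_distrib]
  refine Submodule.sum_mem _ fun m _ => ?_
  have h := Submodule.smul_mem _ ((-1 : ℂ) ^ m * ((m + l).choose l : ℂ))
    (VOA.res_skew hu hv ((b : ℚ) + l) ((l : ℤ) + m + 1))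
  convert h using 1
  rw [smul_sub, smul_smul, smul_smul,
    show (-1 : ℂ) ^ m * ((m + l).choose l : ℂ) * (-1 : ℂ) ^ ((l : ℤ) + m + 1 + 1) =
      (-1 : ℂ) ^ l * ((m + l).choose l : ℂ) by
      rw [show (l : ℤ) + m + 1 + 1 = ((l + m + 2 : ℕ) : ℤ) by push_cast; ring, zpow_natCast]
      have : (-1 : ℂ) ^ m * (-1) ^ m = 1 := by rw [← mul_pow]; simp
      linear_combination ((m + l).choose l : ℂ) * (-1 : ℂ) ^ l * this]
  congr 4
  push_cast; ring

theorem eigProj_mem_of_mem_Ogn (hT : 0 < T) (hg : g.lin ^ T = 1) {x : V.carrier}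
    (hx : x ∈ Ogn V g T l i) {a : ℤ} {u : V.carrier} (hu : u ∈ V.wtSpace a)
    (hu0 : u ∈ eigSpace V g T 0) :
    starFor V l a u (eigProj V g T 0 x) ∈ Ogn V g T l i ∧
      starRevL V l a u (eigProj V g T 0 x) ∈ Ogn V g T l i := by
  suffices h : Ogn V g T l i ≤ (Ogn V g T l i).comap (starForL V l a u ∘ₗ eigProjL g T 0) ⊓
      (Ogn V g T l i).comap (starRevL V l a u ∘ₗ eigProjL g T 0) by
    simpa [starForL_apply, eigProjL_apply] using h hx
  conv_lhs => rw [Ogn]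
  refine Submodule.span_le.2 ?_
  rintro _ (⟨w, rfl⟩ | ⟨r, hr, p, c, d, hc, hcr, rfl⟩)
  · rw [← V.D_apply]
    simp only [SetLike.mem_coe, Submodule.mem_inf, Submodule.mem_comap, LinearMap.comp_apply,
      starForL_apply, eigProjL_apply, eigProj_zero_D]
    exact ⟨starFor_D_mem_Ogn hT hu hu0 _, starRevL_D_mem_Ogn hT hu hu0 _⟩
  · simp only [SetLike.mem_coe, Submodule.mem_inf, Submodule.mem_comap, LinearMap.comp_apply,
      starForL_apply, eigProjL_apply, eigProj_zero_res hT hr hcr, starRevL_apply]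
    have hd := eigProj_mem_eigSpace hT hg (T - r) d
    refine ⟨Submodule.sum_mem _ fun m _ => Submodule.smul_mem _ _ ?_,
      Submodule.sum_mem _ fun m _ => Submodule.smul_mem _ _ ?_⟩
    · convert res_generator_mem_Ogn (l := l) (i := i) hr hu hu0 hc hcr hd (s := l + 1)
        (k := l + m + 1) (by omega) using 2
      · push_cast; ring
      · push_cast; ring
    · convert res_generator_mem_Ogn (l := l) (i := i) hr hu hu0 hc hcr hd (s := m)
        (k := l + m + 1) (by omega) using 2
      push_cast; ring

theorem starFor_mem_eigSpace {r : ℕ} {u v : V.carrier} (hu : u ∈ eigSpace V g T 0)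
    (hv : v ∈ eigSpace V g T r) (k : ℤ) : starFor V l k u v ∈ eigSpace V g T r :=
  Submodule.sum_mem _ fun _ _ => Submodule.smul_mem _ _ (res_mem_eigSpace hu hv _ _)

theorem starFor_zero_left (k : ℤ) (v : V.carrier) : starFor V l k 0 v = 0 := by
  rw [← starForL_apply]; simp

theorem starMul_eq_finsum (hT : 0 < T) {u : V.carrier} (hu : u ∈ eigSpace V g T 0)
    (v : V.carrier) : starMul V g T l u v = ∑ᶠ k : ℤ, starFor V l k (V.proj k u) v := by
  rw [starMul]
  exact finsum_congr fun k => by rw [eigProj_zero_of_mem hT (proj_mem_eigSpace hu k)]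

theorem starMul_mem_eigSpace (hT : 0 < T) {u v : V.carrier} (hu : u ∈ eigSpace V g T 0)
    (hv : v ∈ eigSpace V g T 0) : starMul V g T l u v ∈ eigSpace V g T 0 := by
  rw [starMul_eq_finsum hT hu]
  exact finsum_induction (· ∈ eigSpace V g T 0) (Submodule.zero_mem _)
    (fun _ _ => Submodule.add_mem _)
    fun k => starFor_mem_eigSpace (proj_mem_eigSpace hu k) hv k

theorem starMul_mem_Ogn_of_right (hT : 0 < T) (hg : g.lin ^ T = 1) {u x : V.carrier}
    (hu : u ∈ eigSpace V g T 0) (hx : x ∈ Ogn V g T l i) (hx0 : x ∈ eigSpace V g T 0) :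
    starMul V g T l u x ∈ Ogn V g T l i := by
  rw [starMul_eq_finsum hT hu]
  refine finsum_induction (· ∈ Ogn V g T l i) (Submodule.zero_mem _)
    (fun _ _ => Submodule.add_mem _) fun k => ?_
  have := (eigProj_mem_of_mem_Ogn hT hg hx (VOA.proj_mem k u) (proj_mem_eigSpace hu k)).1
  rwa [eigProj_zero_of_mem hT hx0] at this

theorem starMul_mem_Ogn_of_left (hT : 0 < T) (hg : g.lin ^ T = 1) {u x : V.carrier}
    (hu : u ∈ eigSpace V g T 0) (hx : x ∈ Ogn V g T l i) (hx0 : x ∈ eigSpace V g T 0) :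
    starMul V g T l x u ∈ Ogn V g T l i := by
  obtain ⟨s, hs, hsx⟩ := V.exists_sum_proj x
  have hsum : starMul V g T l x u = (∑ k ∈ s, starForL V l k (V.proj k x)) u := by
    rw [starMul_eq_finsum hT hx0, LinearMap.sum_apply]
    simp only [starForL_apply]
    refine finsum_eq_sum_of_support_subset _ fun k hk => ?_
    by_contra h
    exact hk (by simp only [hs k h, starFor_zero_left])
  rw [hsum]
  have key : eigSpace V g T 0 ≤
      (Ogn V g T l i).comap (∑ k ∈ s, starForL V l k (V.proj k x)) := by
    refine eigSpace_le_of_homogeneous fun a u hu hu0 => ?_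
    have h1 := (eigProj_mem_of_mem_Ogn hT hg hx hu hu0).2
    rw [eigProj_zero_of_mem hT hx0] at h1
    have h2 : ∑ k ∈ s, starFor V l k (V.proj k x) u -
        (-1 : ℂ) ^ l • starRevL V l a u x ∈ Ogn V g T l i := by
      conv => enter [2, 2, 2]; rw [← hsx]
      rw [map_sum, Finset.smul_sum, ← Finset.sum_sub_distrib]
      exact Submodule.sum_mem _ fun k _ => range_D_le_Ogn
        (starFor_sub_starRevL_mem hu (VOA.proj_mem k x))
    rw [Submodule.mem_comap, LinearMap.sum_apply]
    simp only [starForL_apply]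
    exact ((Ogn V g T l i).sub_mem_iff_left (Submodule.smul_mem _ _ h1)).1 h2
  exact key hu

end Products

/-- **Lemma 2.3 (ii).** With `I = O_{g,n}(V) ∩ V^0`, one has `O_{1,l}(V^0) ⊆ I`
and `I/O_{1,l}(V^0)` is a two-sided ideal of the untwisted algebra
`A_{1,l}(V^0) = V^0/O_{1,l}(V^0)` (i.e. `I` is stable under left and right
`*_{g,n}`-multiplication by elements of `V^0`). -/
theorem I_two_sided_ideal (V : VOA) (g : VOAAut V) (T : ℕ) (hT : 0 < T)
    (hg : g.lin ^ T = 1) (l i : ℕ) (hi : i ≤ T - 1) :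
    (OgnV0 V g T l ≤ Ogn V g T l i ⊓ eigSpace V g T 0) ∧
    (∀ u ∈ eigSpace V g T 0, ∀ x ∈ Ogn V g T l i ⊓ eigSpace V g T 0,
      starMul V g T l u x ∈ Ogn V g T l i ⊓ eigSpace V g T 0 ∧
      starMul V g T l x u ∈ Ogn V g T l i ⊓ eigSpace V g T 0) :=
  ⟨OgnV0_le hT, fun _ hu _ ⟨hx, hx0⟩ =>
    ⟨⟨starMul_mem_Ogn_of_right hT hg hu hx hx0, starMul_mem_eigSpace hT hu hx0⟩,
      ⟨starMul_mem_Ogn_of_left hT hg hu hx hx0, starMul_mem_eigSpace hT hx0 hu⟩⟩⟩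

end DLM
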